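/- arXiv:math/0506560 — 14 statements merged into one kernel-verified Lean document; each statement's English description precedes it below -/
import Mathlib

section
/- The following are equivalent: (a) Z is ergodic, i.e. every x ∈ B(H) with Z(x) = x is a scalar multiple of the identity; (b) the vector state ⟨Ω, ·Ω⟩ is absorbing for Z, i.e. for every x ∈ B(H) and all vectors ξ, η ∈ H one has ⟨ξ, Zⁿ(x) η⟩ → ⟨Ω, xΩ⟩ · ⟨ξ, η⟩ as n → ∞. -/
open scoped InnerProductSpace

theorem aux_ks {R : Type*} [Ring R] [StarRing R] [PartialOrder R] [StarOrderedRing R]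
    {d : ℕ} (A : Fin d → R) (hco : ∑ i, A i * star (A i) = 1) (x z : R)
    (hz : z = ∑ i, A i * x * star (A i)) :
    star z * z ≤ ∑ i, A i * (star x * x) * star (A i) := by
  have hzs : star z = ∑ i, A i * star x * star (A i) := by
    rw [hz, star_sum]; simp [mul_assoc]
  have h : ∑ i, star (x * star (A i) - star (A i) * z) * (x * star (A i) - star (A i) * z)
      = (∑ i, A i * (star x * x) * star (A i)) - star z * z := by
    have e : ∀ i, star (x * star (A i) - star (A i) * z) * (x * star (A i) - star (A i) * z)
        = A i * (star x * x) * star (A i) - (A i * star x * star (A i)) * z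
          - star z * (A i * x * star (A i)) + star z * (A i * star (A i)) * z := by
      intro i; simp only [star_sub, star_mul, star_star]; noncomm_ring
    simp only [e, Finset.sum_add_distrib, Finset.sum_sub_distrib, ← Finset.sum_mul,
      ← Finset.mul_sum, hco, ← hzs, ← hz]
    noncomm_ring
  rw [← sub_nonneg, ← h]
  exact Finset.sum_nonneg fun i _ => star_mul_self_nonneg _

theorem aux_sq {R : Type*} [Ring R] [StarRing R] [PartialOrder R] [StarOrderedRing R]
    (s : R) (h0 : 0 ≤ s) (h1 : s ≤ 1) : star s * s ≤ s := by
  have hs : star s = s := (IsSelfAdjoint.of_nonneg h0).star_eq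
  have a1 := star_left_conjugate_nonneg (sub_nonneg.2 h1) s
  have a2 := star_left_conjugate_nonneg h0 (1 - s)
  have e : s - star s * s = star s * (1 - s) * s + star (1 - s) * s * (1 - s) := by
    rw [star_sub, star_one, hs]; noncomm_ring
  rw [← sub_nonneg, e]
  exact add_nonneg a1 a2

section
variable {H : Type*} [NormedAddCommGroup H] [InnerProductSpace ℂ H] [CompleteSpace H]

theorem aux_re_mono {S T : H →L[ℂ] H} (h : S ≤ T) (η : H) :
    RCLike.re ⟪η, S η⟫_ℂ ≤ RCLike.re ⟪η, T η⟫_ℂ := by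
  have := ((ContinuousLinearMap.le_def S T).1 h).re_inner_nonneg_right η
  simp only [ContinuousLinearMap.sub_apply, inner_sub_right, map_sub] at this
  linarith

theorem aux_norm_sq {S T : H →L[ℂ] H} (h : star S * S ≤ T) (η : H) :
    ‖S η‖ ^ 2 ≤ RCLike.re ⟪η, T η⟫_ℂ := by
  have := aux_re_mono h η
  rwa [ContinuousLinearMap.mul_apply, ContinuousLinearMap.star_eq_adjoint,
    ContinuousLinearMap.adjoint_inner_right, inner_self_eq_norm_sq] at this

theorem aux_main (d : ℕ) (A : Fin d → H →L[ℂ] H)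
    (hco : ∑ i, A i * star (A i) = 1)
    (Z : (H →L[ℂ] H) →ₗ[ℂ] (H →L[ℂ] H))
    (hZ : ∀ x, Z x = ∑ i, A i * x * star (A i))
    (Ω : H) (hΩ : ‖Ω‖ = 1)
    (ω : Fin d → ℂ)
    (heig : ∀ i, star (A i) Ω = (starRingEnd ℂ) (ω i) • Ω)
    (herg : ∀ x : H →L[ℂ] H, Z x = x → ∃ c : ℂ, x = c • 1)
    (x : H →L[ℂ] H) (ξ η : H) :
    Filter.Tendsto (fun n : ℕ => ⟪ξ, ((Z^n) x) η⟫_ℂ) Filter.atTop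
          (nhds (⟪Ω, x Ω⟫_ℂ * ⟪ξ, η⟫_ℂ)) := by
  have hZ1 : Z 1 = 1 := by rw [hZ]; simpa using hco
  have hZn1 : ∀ n, (Z^n) 1 = 1 := by
    intro n; induction n with
    | zero => simp
    | succ n ih => rw [pow_succ', Module.End.mul_apply, ih, hZ1]
  have hpos : ∀ x, 0 ≤ x → 0 ≤ Z x := fun x hx => by
    rw [hZ]; exact Finset.sum_nonneg fun i _ => star_right_conjugate_nonneg hx _
  have hmono : ∀ x y, x ≤ y → Z x ≤ Z y := fun x y h => by
    rw [← sub_nonneg, ← map_sub]; exact hpos _ (sub_nonneg.2 h)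
  have hmonon : ∀ n x y, x ≤ y → (Z^n) x ≤ (Z^n) y := by
    intro n; induction n with
    | zero => intro x y h; simpa using h
    | succ n ih =>
      intro x y h; rw [pow_succ', Module.End.mul_apply, Module.End.mul_apply]
      exact hmono _ _ (ih _ _ h)
  have hstar : ∀ x, Z (star x) = star (Z x) := fun x => by
    rw [hZ, hZ, star_sum]; simp [mul_assoc]
  have hstarn : ∀ n x, (Z^n) (star x) = star ((Z^n) x) := by
    intro n; induction n with
    | zero => intro x; simp
    | succ n ih =>
      intro x; rw [pow_succ', Module.End.mul_apply, Module.End.mul_apply, ih, hstar]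
  have hks : ∀ n x, star ((Z^n) x) * (Z^n) x ≤ (Z^n) (star x * x) := by
    intro n; induction n with
    | zero => intro x; simp
    | succ n ih =>
      intro x; rw [pow_succ', Module.End.mul_apply, Module.End.mul_apply]
      refine (aux_ks A hco _ _ (hZ _)).trans ?_
      rw [← hZ]; exact hmono _ _ (ih x)
  have hΩΩ : ⟪Ω, Ω⟫_ℂ = 1 := by rw [inner_self_eq_norm_sq_to_K, hΩ]; simp
  set p : H →L[ℂ] H := InnerProductSpace.rankOne ℂ Ω Ω with hp
  have hpa : ∀ v, p v = ⟪Ω, v⟫_ℂ • Ω := fun v => by simp [hp]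
  have hps : star p = p := by
    rw [ContinuousLinearMap.star_eq_adjoint, hp]; simp
  have hpxp : ∀ x, p * x * p = ⟪Ω, x Ω⟫_ℂ • p := fun x => by
    ext v; simp [hpa, inner_smul_right, smul_smul, mul_comm]
  have hpp : p * p = p := by simpa [hΩ] using hpxp 1
  set q := 1 - p with hq
  have hqs : star q = q := by rw [hq, star_sub, star_one, hps]
  have hqq : star q * q = q := by
    rw [hqs, hq, mul_sub, mul_one, sub_mul, one_mul, hpp]; simp
  have hq0 : 0 ≤ q := by rw [← hqq]; exact star_mul_self_nonneg _
  have hq1 : q ≤ 1 := by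
    rw [hq, sub_le_self_iff, ← hpp]; nth_rw 1 [← hps]; exact star_mul_self_nonneg _
  have hqΩ : q Ω = 0 := by simp [hq, hpa, hΩ]
  have hKΩ : ∀ y : H →L[ℂ] H, y Ω = 0 → Z y Ω = 0 := by
    intro y hy; rw [hZ]; simp [ContinuousLinearMap.sum_apply, heig, hy]
  have hZq : Z q ≤ q := by
    have e1 : Z q * p = 0 := by ext v; simp [hpa, hKΩ q hqΩ]
    have e2 : p * Z q = 0 := by
      have := congrArg star e1
      rwa [star_mul, hps, ← hstar, hqs, star_zero] at this
    have e3 : Z q = star q * Z q * q := by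
      have e4 : q * Z q * q = Z q - p * Z q - Z q * p + (p * Z q) * p := by
        generalize Z q = z
        rw [hq]; noncomm_ring
      rw [hqs, e4, e1, e2]; simp
    have h1 : Z q ≤ 1 := hZ1 ▸ hmono _ _ hq1
    rw [e3]
    calc _ ≤ star q * 1 * q := star_left_conjugate_le_conjugate h1 q
      _ = q := by rw [mul_one, hqq]
  have hanti : Antitone fun n => (Z^n) q := antitone_nat_of_succ_le fun n => by
    rw [pow_succ, Module.End.mul_apply]; exact hmonon n _ _ hZq
  have hn0 : ∀ n, 0 ≤ (Z^n) q := fun n => by simpa using hmonon n _ _ hq0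
  have hn1 : ∀ n, (Z^n) q ≤ 1 := fun n => by simpa [hZn1] using hmonon n _ _ hq1
  have hlim : ∀ v, ∃ w, Filter.Tendsto (fun n => ((Z^n) q) v) Filter.atTop (nhds w) := by
    intro v
    set r : ℕ → ℝ := fun n => RCLike.re ⟪v, ((Z^n) q) v⟫_ℂ with hr
    have hra : Antitone r := fun m n h => aux_re_mono (hanti h) v
    have hrb : BddBelow (Set.range r) := ⟨0, by
      rintro _ ⟨n, rfl⟩; simpa [hr] using aux_re_mono (hn0 n) v⟩
    have hrc : CauchySeq r := (tendsto_atTop_ciInf hra hrb).cauchySeq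
    apply cauchySeq_tendsto_of_complete
    have key : ∀ m n, m ≤ n → ‖((Z^m) q) v - ((Z^n) q) v‖ ^ 2 ≤ r m - r n := by
      intro m n h
      have := aux_norm_sq (aux_sq _ (sub_nonneg.2 (hanti h))
        ((sub_le_self _ (hn0 n)).trans (hn1 m))) v
      simpa [hr, inner_sub_right] using this
    rw [Metric.cauchySeq_iff'] at hrc ⊢
    intro ε hε
    obtain ⟨N, hN⟩ := hrc (ε ^ 2) (by positivity)
    refine ⟨N, fun n hn => ?_⟩
    have h1 := key N n hn
    have h2 := hN n hn
    rw [dist_comm, Real.dist_eq] at h2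
    rw [dist_comm, dist_eq_norm]
    exact lt_of_pow_lt_pow_left₀ 2 hε.le (h1.trans_lt ((le_abs_self _).trans_lt h2))
  choose f hf using hlim
  have hf' : Filter.Tendsto (fun n v => ((Z^n) q) v) Filter.atTop (nhds f) :=
    tendsto_pi_nhds.2 hf
  set Q : H →L[ℂ] H := continuousLinearMapOfTendsto (fun n => (Z^n) q) hf' with hQ
  have hQf : ∀ v, Q v = f v := fun v => rfl
  have hZQ : Z Q = Q := by
    ext v
    have t1 : Filter.Tendsto (fun n => ((Z^(n+1)) q) v) Filter.atTop (nhds (Z Q v)) := by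
      simp only [pow_succ', Module.End.mul_apply]
      simp only [hZ, ContinuousLinearMap.sum_apply, ContinuousLinearMap.mul_apply]
      exact tendsto_finset_sum _ fun i _ => ((A i).continuous.tendsto _).comp (hf _)
    exact tendsto_nhds_unique t1 ((hf v).comp (Filter.tendsto_add_atTop_nat 1))
  have hQ0 : Q = 0 := by
    obtain ⟨c, hc⟩ := herg Q hZQ
    have hz : ∀ n, ((Z^n) q) Ω = 0 := by
      intro n; induction n with
      | zero => simpa using hqΩ
      | succ n ih => rw [pow_succ', Module.End.mul_apply]; exact hKΩ _ ih
    have h1 : Q Ω = 0 := by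
      have := hf Ω
      simp only [hz] at this
      exact tendsto_nhds_unique this tendsto_const_nhds
    have hΩ0 : Ω ≠ 0 := by rintro rfl; simp at hΩ
    rw [hc] at h1
    have : c = 0 := by simpa [hΩ0] using h1
    rw [hc, this, zero_smul]
  have hqlim : ∀ v, Filter.Tendsto (fun n => ((Z^n) q) v) Filter.atTop (nhds 0) := by
    intro v; have := hf v; rwa [← hQf, hQ0] at this
  have hyq : ∀ (y : H →L[ℂ] H) v,
      Filter.Tendsto (fun n => ((Z^n) (y * q)) v) Filter.atTop (nhds 0) := by
    intro y v
    have hb : star (y * q) * (y * q) ≤ ((‖star y * y‖ : ℝ) : ℂ) • q := by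
      have := CStarAlgebra.star_left_conjugate_le_norm_smul (a := q) (b := star y * y)
        (IsSelfAdjoint.star_mul_self y)
      rw [hqq] at this
      rw [star_mul]
      simpa [mul_assoc] using this
    have hbn : ∀ n, ‖((Z^n) (y * q)) v‖ ^ 2
        ≤ RCLike.re ⟪v, (((‖star y * y‖ : ℝ) : ℂ) • ((Z^n) q) v)⟫_ℂ := by
      intro n
      have := aux_norm_sq ((hks n (y * q)).trans (hmonon n _ _ hb)) v
      rwa [map_smul, ContinuousLinearMap.smul_apply] at this
    have t : Filter.Tendsto (fun n =>
        RCLike.re ⟪v, (((‖star y * y‖ : ℝ) : ℂ) • ((Z^n) q) v)⟫_ℂ) Filter.atTop (nhds 0) := by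
      have h1 := ((hqlim v).const_smul ((‖star y * y‖ : ℝ) : ℂ))
      have h2 := (RCLike.continuous_re (K := ℂ)).tendsto _ |>.comp
        ((tendsto_const_nhds (x := v)).inner (𝕜 := ℂ) h1)
      simp only [smul_zero, inner_zero_right, map_zero] at h2
      exact h2
    have t2 := squeeze_zero (fun n => by positivity) hbn t
    rw [tendsto_zero_iff_norm_tendsto_zero]
    have t3 := t2.sqrt
    simpa using t3
  have hdec : x = ⟪Ω, x Ω⟫_ℂ • (1 - q) + x * q + star (star (x * p) * q) := by
    have : (1 : H →L[ℂ] H) - q = p := by rw [hq]; abel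
    rw [this, ← hpxp, star_mul, star_star, hqs, hq]; noncomm_ring
  have e : ∀ n, ⟪ξ, ((Z^n) x) η⟫_ℂ = ⟪Ω, x Ω⟫_ℂ * (⟪ξ, η⟫_ℂ - ⟪ξ, ((Z^n) q) η⟫_ℂ)
      + ⟪ξ, ((Z^n) (x * q)) η⟫_ℂ + ⟪((Z^n) (star (x * p) * q)) ξ, η⟫_ℂ := by
    intro n
    conv_lhs => rw [hdec]
    rw [map_add, map_add, map_smul, map_sub, hZn1, hstarn]
    simp only [ContinuousLinearMap.add_apply, ContinuousLinearMap.smul_apply,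
      ContinuousLinearMap.sub_apply, ContinuousLinearMap.one_apply, inner_add_right,
      inner_sub_right, inner_smul_right, ContinuousLinearMap.star_eq_adjoint,
      ContinuousLinearMap.adjoint_inner_right]
  simp only [e]
  have c : Filter.Tendsto (fun _ : ℕ => ξ) Filter.atTop (nhds ξ) := tendsto_const_nhds
  have c' : Filter.Tendsto (fun _ : ℕ => η) Filter.atTop (nhds η) := tendsto_const_nhds
  have T := (((tendsto_const_nhds (x := ⟪ξ, η⟫_ℂ)).sub
    (c.inner (𝕜 := ℂ) (hqlim η))).const_mul ⟪Ω, x Ω⟫_ℂ).add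
    (c.inner (𝕜 := ℂ) (hyq x η)) |>.add ((hyq (star (x * p)) ξ).inner (𝕜 := ℂ) c')
  simpa using T

end


open scoped InnerProductSpace

/-- For a coisometric row contraction `A = (A₁, …, A_d)` on a complex
Hilbert space `H`, with `Z(x) = ∑ i, A i ∘ x ∘ (A i)*`, a unit vector `Ω` and
`ω ∈ ℂ^d` with `∑ |ωᵢ|² = 1` such that `(A i)* Ω = conj (ω i) • Ω`, the following
are equivalent: (a) `Z` is ergodic; (b) the vector state `⟨Ω, ·Ω⟩` is absorbing for `Z`. -/
theorem ergodic_iff_absorbing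
    {H : Type*} [NormedAddCommGroup H] [InnerProductSpace ℂ H] [CompleteSpace H]
    (d : ℕ) (hd : 2 ≤ d) (A : Fin d → H →L[ℂ] H)
    (hco : ∑ i, A i ∘L ContinuousLinearMap.adjoint (A i) = 1)
    (Z : (H →L[ℂ] H) → (H →L[ℂ] H))
    (hZ : ∀ x, Z x = ∑ i, A i ∘L x ∘L ContinuousLinearMap.adjoint (A i))
    (Ω : H) (hΩ : ‖Ω‖ = 1)
    (ω : Fin d → ℂ) (hω : ∑ i, ‖ω i‖ ^ 2 = 1)
    (heig : ∀ i, ContinuousLinearMap.adjoint (A i) Ω = (starRingEnd ℂ) (ω i) • Ω) :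
    (∀ x : H →L[ℂ] H, Z x = x → ∃ c : ℂ, x = c • 1) ↔
      (∀ (x : H →L[ℂ] H) (ξ η : H),
        Filter.Tendsto (fun n : ℕ => ⟪ξ, (Z^[n] x) η⟫_ℂ) Filter.atTop
          (nhds (⟪Ω, x Ω⟫_ℂ * ⟪ξ, η⟫_ℂ))) := by

  constructor
  · intro herg
    let Zl : (H →L[ℂ] H) →ₗ[ℂ] (H →L[ℂ] H) :=
      { toFun := Z
        map_add' := fun x y => by
          simp only [hZ, ← Finset.sum_add_distrib]
          refine Finset.sum_congr rfl fun i _ => ?_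
          ext v; simp
        map_smul' := fun c x => by
          simp only [hZ, Finset.smul_sum]
          refine Finset.sum_congr rfl fun i _ => ?_
          ext v; simp }
    have hZl : Z = ⇑Zl := rfl
    intro x ξ η
    have := aux_main d A hco Zl (fun x => hZ x) Ω hΩ ω heig herg x ξ η
    simpa only [hZl, ← Module.End.coe_pow] using this
  · intro h x hx
    refine ⟨⟪Ω, x Ω⟫_ℂ, ?_⟩
    ext η
    refine ext_inner_left ℂ fun ξ => ?_
    have h1 := h x ξ η
    simp only [Function.iterate_fixed hx] at h1
    have := tendsto_nhds_unique tendsto_const_nhds h1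
    simpa [inner_smul_right] using this
end

section
/- If Z is ergodic, then the invariant vector state is unique: whenever Ω′ ∈ H is a unit vector with ⟨Ω′, Z(x)Ω′⟩ = ⟨Ω′, xΩ′⟩ for all x ∈ B(H), there exists c ∈ ℂ with |c| = 1 such that Ω′ = c·Ω. -/
open scoped InnerProductSpace

open Filter Topology ContinuousLinearMap in
theorem aux_norm_sq_le {H : Type*} [NormedAddCommGroup H] [InnerProductSpace ℂ H] [CompleteSpace H]
    (T : H →L[ℂ] H) (h0 : 0 ≤ T) (h1 : T ≤ 1) (v : H) :
    ‖T v‖ ^ 2 ≤ (⟪T v, v⟫_ℂ).re := by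
  have hT := (nonneg_iff_isPositive T).1 h0
  have hS : (1 - T).IsPositive := h1
  have e1 := hS.re_inner_nonneg_left (T v)
  have e2 := hT.re_inner_nonneg_left (v - T v)
  have e3 := hT.inner_left_eq_inner_right (T v) v
  have e4 : (⟪T v, T v⟫_ℂ).re = ‖T v‖ ^ 2 := by
    simpa using inner_self_eq_norm_sq (𝕜 := ℂ) (T v)
  simp only [sub_apply, one_apply_eq_self, map_sub, inner_sub_left, inner_sub_right, e3, RCLike.re_eq_complex_re] at e1 e2
  linarith

open Filter Topology ContinuousLinearMap in
theorem aux_limit {H : Type*} [NormedAddCommGroup H] [InnerProductSpace ℂ H] [CompleteSpace H]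
    (p : ℕ → H →L[ℂ] H) (h0 : ∀ n, 0 ≤ p n) (h1 : ∀ n, p n ≤ 1) (hm : Monotone p) :
    ∃ x : H →L[ℂ] H, ∀ v, Tendsto (fun n => p n v) atTop (𝓝 (x v)) := by
  have hc : ∀ v, CauchySeq (fun n => p n v) := by
    intro v
    have key : ∀ m n, m ≤ n → ‖p n v - p m v‖ ^ 2 ≤ (⟪p n v, v⟫_ℂ).re - (⟪p m v, v⟫_ℂ).re := by
      intro m n hmn
      have := aux_norm_sq_le (p n - p m) (sub_nonneg.2 (hm hmn))
        ((sub_le_self _ (h0 m)).trans (h1 n)) v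
      simpa [inner_sub_left] using this
    have hmono : Monotone (fun n => (⟪p n v, v⟫_ℂ).re) := by
      intro m n hmn
      have := key m n hmn
      have := sq_nonneg ‖p n v - p m v‖
      simp only
      linarith
    have hb : BddAbove (Set.range (fun n => (⟪p n v, v⟫_ℂ).re)) := by
      refine ⟨(⟪v, v⟫_ℂ).re, ?_⟩
      rintro _ ⟨n, rfl⟩
      have hS : (1 - p n).IsPositive := h1 n
      have := hS.re_inner_nonneg_left v
      simp only [sub_apply, one_apply_eq_self, map_sub, inner_sub_left, RCLike.re_eq_complex_re] at this
      simp only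
      linarith
    have hcs := (tendsto_atTop_ciSup hmono hb).cauchySeq
    rw [Metric.cauchySeq_iff'] at hcs ⊢
    intro ε hε
    obtain ⟨N, hN⟩ := hcs (ε ^ 2) (by positivity)
    refine ⟨N, fun n hn => ?_⟩
    have a := hN n hn
    rw [Real.dist_eq] at a
    have b := key N n hn
    have c := (le_abs_self _).trans_lt a
    rw [dist_eq_norm]
    exact lt_of_pow_lt_pow_left₀ 2 hε.le (b.trans_lt c)
  choose f hf using fun v => cauchySeq_tendsto_of_complete (hc v)
  exact ⟨continuousLinearMapOfTendsto p (tendsto_pi_nhds.2 hf), hf⟩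

/-- If the map `Z(x) = ∑ i, A i ∘ x ∘ (A i)*` associated to an ergodic
coisometric row contraction is ergodic, then the invariant vector state is unique up to
a unimodular constant. -/
theorem invariant_vector_state_unique
    {H : Type*} [NormedAddCommGroup H] [InnerProductSpace ℂ H] [CompleteSpace H]
    (d : ℕ) (hd : 2 ≤ d) (A : Fin d → H →L[ℂ] H)
    (hco : ∑ i, A i ∘L ContinuousLinearMap.adjoint (A i) = 1)
    (Z : (H →L[ℂ] H) → (H →L[ℂ] H))
    (hZ : ∀ x, Z x = ∑ i, A i ∘L x ∘L ContinuousLinearMap.adjoint (A i))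
    (hergodic : ∀ x : H →L[ℂ] H, Z x = x → ∃ c : ℂ, x = c • 1)
    (Ω : H) (hΩ : ‖Ω‖ = 1)
    (ω : Fin d → ℂ) (hω : ∑ i, ‖ω i‖ ^ 2 = 1)
    (heig : ∀ i, ContinuousLinearMap.adjoint (A i) Ω = (starRingEnd ℂ) (ω i) • Ω)
    (Ω' : H) (hΩ' : ‖Ω'‖ = 1)
    (hinv : ∀ x : H →L[ℂ] H, ⟪Ω', (Z x) Ω'⟫_ℂ = ⟪Ω', x Ω'⟫_ℂ) :
    ∃ c : ℂ, ‖c‖ = 1 ∧ Ω' = c • Ω := by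
  have hmonoZ : ∀ x y, x ≤ y → Z x ≤ Z y := by
    intro x y hxy
    have hp : (y - x).IsPositive := hxy
    rw [ContinuousLinearMap.le_def]
    have : Z y - Z x = ∑ i, A i ∘L (y - x) ∘L ContinuousLinearMap.adjoint (A i) := by
      rw [hZ, hZ, ← Finset.sum_sub_distrib]
      refine Finset.sum_congr rfl fun i _ => ?_
      ext v; simp
    rw [this]
    exact ContinuousLinearMap.isPositive_sum _ fun i _ => hp.conj_adjoint (A i)
  have hZ1 : Z 1 = 1 := by
    rw [hZ, ← hco]
    refine Finset.sum_congr rfl fun i _ => ?_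
    rw [hco]; rfl
  have hZ0 : Z 0 = 0 := by
    rw [hZ]; simp
  have hZΩ : ∀ x : H →L[ℂ] H, x Ω = Ω → Z x Ω = Ω := by
    intro x hx
    have h := congrArg (fun T : H →L[ℂ] H => T Ω) hco
    simp only [sum_apply, ContinuousLinearMap.comp_apply, heig,
      one_apply_eq_self, map_smul] at h
    rw [hZ]
    simp only [sum_apply, ContinuousLinearMap.comp_apply, heig, map_smul, hx]
    exact h
  set P : H →L[ℂ] H := InnerProductSpace.rankOne ℂ Ω Ω with hP
  have hstar : IsStarProjection P := InnerProductSpace.isStarProjection_rankOne_self hΩ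
  have hPΩ : P Ω = Ω := by
    simp [hP, hΩ]
  have hP0 : 0 ≤ P := hstar.nonneg
  have hP1 : P ≤ 1 := hstar.le_one
  set p : ℕ → H →L[ℂ] H := fun n => Z^[n] P with hp
  have hs : ∀ n, p (n + 1) = Z (p n) := fun n => Function.iterate_succ_apply' Z n P
  have h0 : ∀ n, 0 ≤ p n := by
    intro n
    induction n with
    | zero => exact hP0
    | succ k ih => rw [hs, ← hZ0]; exact hmonoZ _ _ ih
  have h1 : ∀ n, p n ≤ 1 := by
    intro n
    induction n with
    | zero => exact hP1
    | succ k ih => rw [hs, ← hZ1]; exact hmonoZ _ _ ih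
  have hpΩ : ∀ n, p n Ω = Ω := by
    intro n
    induction n with
    | zero => exact hPΩ
    | succ k ih => rw [hs]; exact hZΩ _ ih
  have hstep0 : p 0 ≤ p 1 := by
    have hT := (ContinuousLinearMap.nonneg_iff_isPositive _).1 (h0 1)
    have hc := hT.adjoint_conj (1 - P)
    rw [ContinuousLinearMap.le_def]
    convert hc using 1
    have had : ContinuousLinearMap.adjoint (1 - P) = 1 - P :=
      (hstar.one_sub).isSelfAdjoint.adjoint_eq
    rw [had]
    have hin : ∀ v, ⟪Ω, p 1 v⟫_ℂ = ⟪Ω, v⟫_ℂ := by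
      intro v
      rw [← hT.inner_left_eq_inner_right, hpΩ]
    have h00 : p 0 = P := rfl
    ext v
    have hPv : ∀ w, P w = ⟪Ω, w⟫_ℂ • Ω := fun w => rfl
    simp only [h00, sub_apply, ContinuousLinearMap.comp_apply,
      one_apply_eq_self, map_sub]
    rw [hPv (p 1 v), hin, hPv v, map_smul, hpΩ, map_smul, hPΩ]
    abel
  have hm : Monotone p := by
    refine monotone_nat_of_le_succ fun n => ?_
    induction n with
    | zero => exact hstep0
    | succ k ih => rw [hs k, hs (k+1)]; exact hmonoZ _ _ ih
  obtain ⟨x, hx⟩ := aux_limit p h0 h1 hm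
  have hfix : Z x = x := by
    ext v
    have l1 : Filter.Tendsto (fun n => p (n+1) v) Filter.atTop (nhds (x v)) :=
      (hx v).comp (Filter.tendsto_add_atTop_nat 1)
    have l2 : Filter.Tendsto (fun n => p (n+1) v) Filter.atTop (nhds (Z x v)) := by
      simp only [hs, hZ, sum_apply, ContinuousLinearMap.comp_apply]
      exact tendsto_finsetSum _ fun i _ => ((A i).continuous.tendsto _).comp (hx _)
    exact tendsto_nhds_unique l2 l1
  obtain ⟨c, hc⟩ := hergodic x hfix
  have hΩ0 : Ω ≠ 0 := by
    rintro rfl; simp at hΩ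
  have hxΩ : x Ω = Ω := by
    refine tendsto_nhds_unique (hx Ω) ?_
    simp only [hpΩ]; exact tendsto_const_nhds
  have hc1 : c = 1 := by
    rw [hc] at hxΩ
    have : (c - 1) • Ω = 0 := by
      rw [sub_smul, one_smul, sub_eq_zero]; simpa using hxΩ
    exact sub_eq_zero.1 ((smul_eq_zero.1 this).resolve_right hΩ0)
  have hconst : ∀ n, ⟪Ω', p n Ω'⟫_ℂ = ⟪Ω', P Ω'⟫_ℂ := by
    intro n
    induction n with
    | zero => rfl
    | succ k ih => rw [hs, hinv, ih]
  have hlim : ⟪Ω', P Ω'⟫_ℂ = ⟪Ω', x Ω'⟫_ℂ := by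
    have l := Filter.Tendsto.inner (𝕜 := ℂ) (tendsto_const_nhds (x := Ω')) (hx Ω')
    simp only [hconst] at l
    exact tendsto_nhds_unique tendsto_const_nhds l
  have hn : ‖⟪Ω, Ω'⟫_ℂ‖ = 1 := by
    have h2 : ⟪Ω, Ω'⟫_ℂ * ⟪Ω', Ω⟫_ℂ = 1 := by
      have : ⟪Ω', P Ω'⟫_ℂ = ⟪Ω, Ω'⟫_ℂ * ⟪Ω', Ω⟫_ℂ := by
        simp [hP, inner_smul_right]
      rw [← this, hlim, hc, hc1]
      simp [hΩ']
    have h3 := congrArg norm h2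
    rw [norm_mul, norm_inner_symm Ω' Ω, norm_one] at h3
    nlinarith [norm_nonneg ⟪Ω, Ω'⟫_ℂ]
  have hΩ'0 : Ω' ≠ 0 := by
    rintro rfl; simp at hΩ'
  obtain ⟨r, -, hr⟩ := (norm_inner_eq_norm_iff (𝕜 := ℂ) hΩ0 hΩ'0).1 (by rw [hn, hΩ, hΩ', one_mul])
  refine ⟨r, ?_, hr⟩
  rw [hr, norm_smul, hΩ, mul_one] at hΩ'
  exact hΩ'
end

section
/- The coisometric row contraction A = (A₁,…,A_d) is ergodic and Ω is a common eigenvector of the adjoints A₁*,…,A_d* (i.e. each A_i*Ω is a scalar multiple of Ω) if and only if H° = {Ω}⊥ is invariant under each A_i and the restricted row contraction (Å₁,…,Å_d) on H° is *-stable, i.e. for every h ∈ H°, lim_{n→∞} ∑_{α ∈ {1,…,d}ⁿ} ‖Å_α* h‖² = 0. -/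
open scoped InnerProductSpace

namespace ErgStab

open ContinuousLinearMap Filter Topology

section
variable {H : Type*} [NormedAddCommGroup H] [InnerProductSpace ℂ H] [CompleteSpace H]

/-- The completely positive map. -/
noncomputable def Z {d : ℕ} (A : Fin d → H →L[ℂ] H) (x : H →L[ℂ] H) : H →L[ℂ] H :=
  ∑ i, A i ∘L x ∘L adjoint (A i)

/-- The iterates. -/
noncomputable def T {d : ℕ} (A : Fin d → H →L[ℂ] H) (Ω : H) : ℕ → (H →L[ℂ] H)
  | 0 => (Submodule.span ℂ {Ω})ᗮ.starProjection
  | n + 1 => Z A (T A Ω n)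

lemma one_apply_eq (h : H) : (1 : H →L[ℂ] H) h = h := rfl

lemma Z_apply {d : ℕ} (A : Fin d → H →L[ℂ] H) (x : H →L[ℂ] H) (h : H) :
    Z A x h = ∑ i, A i (x (adjoint (A i) h)) := by
  simp [Z, sum_apply]

lemma inner_Z {d : ℕ} (A : Fin d → H →L[ℂ] H) (x : H →L[ℂ] H) (h k : H) :
    ⟪Z A x h, k⟫_ℂ = ∑ i, ⟪x (adjoint (A i) h), adjoint (A i) k⟫_ℂ := by
  simp [Z_apply, sum_inner, adjoint_inner_right]

lemma Z_pos {d : ℕ} (A : Fin d → H →L[ℂ] H) {x : H →L[ℂ] H} (hx : x.IsPositive) :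
    (Z A x).IsPositive :=
  isPositive_sum _ fun i _ => hx.conj_adjoint (A i)

lemma Z_sub {d : ℕ} (A : Fin d → H →L[ℂ] H) (x y : H →L[ℂ] H) :
    Z A (x - y) = Z A x - Z A y := by
  ext h
  simp [Z_apply, Finset.sum_sub_distrib]

lemma sum_norm {d : ℕ} (A : Fin d → H →L[ℂ] H)
    (hco : ∑ i, A i ∘L adjoint (A i) = 1) (h : H) :
    ∑ i, ‖adjoint (A i) h‖ ^ 2 = ‖h‖ ^ 2 := by
  have h1 : ⟪Z A 1 h, h⟫_ℂ = ⟪h, h⟫_ℂ := by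
    have : Z A 1 = 1 := hco
    rw [this]; rfl
  rw [inner_Z] at h1
  simp only [one_apply_eq, inner_self_eq_norm_sq_to_K] at h1
  exact_mod_cast h1

lemma sq_le {D : H →L[ℂ] H} (h0 : D.IsPositive) (h1 : (1 - D).IsPositive) (h : H) :
    ‖D h‖ ^ 2 ≤ (⟪D h, h⟫_ℂ).re := by
  have e1 := h1.re_inner_nonneg_left (D h)
  have e2 := h0.re_inner_nonneg_left (h - D h)
  have e3 : ⟪D (D h), h⟫_ℂ = ⟪D h, D h⟫_ℂ := h0.inner_left_eq_inner_right _ _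
  have e4 : (⟪D h, D h⟫_ℂ).re = ‖D h‖ ^ 2 := inner_self_eq_norm_sq (𝕜 := ℂ) (D h)
  simp only [sub_apply, one_apply_eq, map_sub, inner_sub_left, inner_sub_right, e3] at e1 e2
  simp only [RCLike.re_to_complex, e4] at e1 e2
  linarith

lemma exists_lim (t : ℕ → H →L[ℂ] H) (h0 : ∀ n, (t n).IsPositive) (h1 : (1 - t 0).IsPositive)
    (hs : ∀ n, (t n - t (n+1)).IsPositive) :
    ∃ L : H →L[ℂ] H, ∀ h, Tendsto (fun n => t n h) atTop (𝓝 (L h)) := by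
  have anti : Antitone t := antitone_nat_of_succ_le fun n => (le_def _ _).2 (hs n)
  have key : ∀ h, ∃ y, Tendsto (fun n => t n h) atTop (𝓝 y) := by
    intro h
    have ganti : Antitone fun n => (⟪t n h, h⟫_ℂ).re := by
      intro m n hmn
      have := ((le_def _ _).1 (anti hmn)).re_inner_nonneg_left h
      simp only [sub_apply, inner_sub_left, map_sub, RCLike.re_to_complex] at this
      simpa using this
    have gb : BddBelow (Set.range fun n => (⟪t n h, h⟫_ℂ).re) :=
      ⟨0, by rintro _ ⟨n, rfl⟩; exact (h0 n).re_inner_nonneg_left h⟩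
    have gc := (tendsto_atTop_ciInf ganti gb).cauchySeq
    apply cauchySeq_tendsto_of_complete
    rw [Metric.cauchySeq_iff'] at gc ⊢
    intro ε hε
    obtain ⟨N, hN⟩ := gc (ε ^ 2) (by positivity)
    refine ⟨N, fun n hn => ?_⟩
    have hn' := hN n hn
    have p1 : (t N - t n).IsPositive := (le_def _ _).1 (anti hn)
    have p2 : (1 - (t N - t n)).IsPositive := by
      have a : (t 0 - t N).IsPositive := (le_def _ _).1 (anti (Nat.zero_le N))
      have : 1 - (t N - t n) = (1 - t 0) + (t 0 - t N) + t n := by abel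
      rw [this]
      exact (h1.add a).add (h0 n)
    have := sq_le p1 p2 h
    rw [dist_comm, dist_eq_norm]
    rw [dist_comm, Real.dist_eq] at hn'
    have b := lt_of_abs_lt hn'
    simp only [sub_apply, inner_sub_left, Complex.sub_re] at this
    exact lt_of_pow_lt_pow_left₀ 2 hε.le (by linarith)
  choose f hf using key
  exact ⟨continuousLinearMapOfTendsto (f := f) t (tendsto_pi_nhds.2 hf), hf⟩

lemma T_pos {d : ℕ} (A : Fin d → H →L[ℂ] H) (Ω : H) (n : ℕ) : (T A Ω n).IsPositive := by
  induction n with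
  | zero => exact IsPositive.of_isStarProjection isStarProjection_starProjection
  | succ n ih => exact Z_pos A ih

lemma sub_Q (Ω k : H) :
    ∃ c : ℂ, k = (Submodule.span ℂ {Ω})ᗮ.starProjection k + c • Ω := by
  have := Submodule.starProjection_add_starProjection_orthogonal
    (K := Submodule.span ℂ {Ω}) k
  have h2 := Submodule.starProjection_apply_mem (Submodule.span ℂ {Ω}) k
  obtain ⟨c, hc⟩ := Submodule.mem_span_singleton.1 h2
  exact ⟨c, by rw [hc, add_comm]; exact this.symm⟩

lemma QΩ (Ω : H) : (Submodule.span ℂ {Ω})ᗮ.starProjection Ω = 0 :=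
  Submodule.starProjection_orthogonalComplement_singleton_eq_zero Ω

lemma T_Ω {d : ℕ} (A : Fin d → H →L[ℂ] H) (Ω : H)
    (he : ∀ i, ∃ c : ℂ, adjoint (A i) Ω = c • Ω) (n : ℕ) : T A Ω n Ω = 0 := by
  induction n with
  | zero => exact QΩ Ω
  | succ n ih =>
    rw [T, Z_apply]
    refine Finset.sum_eq_zero fun i _ => ?_
    obtain ⟨c, hc⟩ := he i
    simp [hc, ih]

lemma T_Q {d : ℕ} (A : Fin d → H →L[ℂ] H) (Ω : H)
    (he : ∀ i, ∃ c : ℂ, adjoint (A i) Ω = c • Ω) (n : ℕ) (k : H) :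
    ⟪T A Ω n ((Submodule.span ℂ {Ω})ᗮ.starProjection k),
      (Submodule.span ℂ {Ω})ᗮ.starProjection k⟫_ℂ = ⟪T A Ω n k, k⟫_ℂ := by
  obtain ⟨c, hc⟩ := sub_Q Ω k
  set q := (Submodule.span ℂ {Ω})ᗮ.starProjection k
  have h1 : T A Ω n k = T A Ω n q := by rw [hc]; simp [T_Ω A Ω he n]
  rw [h1]
  rw [(T_pos A Ω n).inner_left_eq_inner_right q k, h1, 
    (T_pos A Ω n).inner_left_eq_inner_right q q]

lemma norm_Q_sq (Ω h : H) : (⟪(Submodule.span ℂ {Ω})ᗮ.starProjection h, h⟫_ℂ).re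
    = ‖(Submodule.span ℂ {Ω})ᗮ.starProjection h‖ ^ 2 := by
  have := Submodule.inner_starProjection_left_eq_right (Submodule.span ℂ {Ω})ᗮ
    ((Submodule.span ℂ {Ω})ᗮ.starProjection h) h
  have e2 : (Submodule.span ℂ {Ω})ᗮ.starProjection ((Submodule.span ℂ {Ω})ᗮ.starProjection h)
    = (Submodule.span ℂ {Ω})ᗮ.starProjection h :=
      Submodule.starProjection_eq_self_iff.2 (Submodule.starProjection_apply_mem _ _)
  rw [e2] at this
  rw [this]
  exact inner_self_eq_norm_sq (𝕜 := ℂ) _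

lemma norm_Q_le (Ω h : H) : ‖(Submodule.span ℂ {Ω})ᗮ.starProjection h‖ ≤ ‖h‖ :=
  Submodule.norm_starProjection_apply_le _ _

lemma T_step {d : ℕ} (A : Fin d → H →L[ℂ] H) (Ω : H)
    (hco : ∑ i, A i ∘L adjoint (A i) = 1)
    (he : ∀ i, ∃ c : ℂ, adjoint (A i) Ω = c • Ω) (n : ℕ) :
    (T A Ω n - T A Ω (n+1)).IsPositive := by
  induction n with
  | zero =>
    refine ⟨((T_pos A Ω 0).isSymmetric).sub (T_pos A Ω 1).isSymmetric, fun h => ?_⟩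
    simp only [reApplyInnerSelf_apply, LinearMap.sub_apply, sub_apply, inner_sub_left, map_sub, sub_nonneg]
    show (⟪T A Ω 1 h, h⟫_ℂ).re ≤ (⟪T A Ω 0 h, h⟫_ℂ).re
    rw [show T A Ω 1 = Z A (T A Ω 0) from rfl, inner_Z, T, norm_Q_sq, Complex.re_sum, ← sum_norm A hco]
    refine Finset.sum_le_sum fun i _ => ?_
    rw [norm_Q_sq]
    obtain ⟨c, hc⟩ := sub_Q Ω h
    obtain ⟨e, hce⟩ := he i
    set q := (Submodule.span ℂ {Ω})ᗮ.starProjection h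
    have : (Submodule.span ℂ {Ω})ᗮ.starProjection (adjoint (A i) h)
      = (Submodule.span ℂ {Ω})ᗮ.starProjection (adjoint (A i) q) := by
      rw [hc, map_add, map_add, map_smul, map_smul, hce, map_smul, QΩ, smul_zero, smul_zero, add_zero]
    rw [this]
    gcongr
    exact norm_Q_le _ _
  | succ n ih =>
    have := Z_pos A ih
    rwa [Z_sub] at this

lemma one_sub_T {d : ℕ} (A : Fin d → H →L[ℂ] H) (Ω : H) : (1 - T A Ω 0).IsPositive := by
  have : (1 - T A Ω 0) = (Submodule.span ℂ {Ω}).starProjection := by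
    rw [T, Submodule.starProjection_orthogonal']; abel
  rw [this]
  exact IsPositive.of_isStarProjection isStarProjection_starProjection

lemma sum_eq {d : ℕ} (A : Fin d → H →L[ℂ] H) (Ω : H)
    (he : ∀ i, ∃ c : ℂ, adjoint (A i) Ω = c • Ω)
    (Ar : Fin d → ((Submodule.span ℂ {Ω})ᗮ : Submodule ℂ H) →L[ℂ]
      ((Submodule.span ℂ {Ω})ᗮ : Submodule ℂ H))
    (hAr : ∀ (i : Fin d) (h : ((Submodule.span ℂ {Ω})ᗮ : Submodule ℂ H)),
      (Ar i h : H) = A i (h : H)) (n : ℕ) (h : ((Submodule.span ℂ {Ω})ᗮ : Submodule ℂ H)) :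
    ∑ α : Fin n → Fin d, ‖adjoint ((List.ofFn fun k => Ar (α k)).prod) h‖ ^ 2
      = (⟪T A Ω n h, (h : H)⟫_ℂ).re := by
  induction n generalizing h with
  | zero =>
    have e : (Submodule.span ℂ {Ω})ᗮ.starProjection (h : H) = h :=
      Submodule.starProjection_eq_self_iff.2 h.2
    have e1 : adjoint (1 : ((Submodule.span ℂ {Ω})ᗮ : Submodule ℂ H) →L[ℂ]
      ((Submodule.span ℂ {Ω})ᗮ : Submodule ℂ H)) = 1 := star_one _
    rw [T, norm_Q_sq, e]
    simp [e1]
  | succ n ih =>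
    rw [T, inner_Z, Complex.re_sum, ← (Fin.consEquiv fun _ => Fin d).sum_comp,
      Fintype.sum_prod_type]
    refine Finset.sum_congr rfl fun i _ => ?_
    have e : ((adjoint (Ar i) h : ((Submodule.span ℂ {Ω})ᗮ : Submodule ℂ H)) : H)
        = (Submodule.span ℂ {Ω})ᗮ.starProjection (adjoint (A i) (h : H)) := by
      symm
      apply Submodule.eq_starProjection_of_mem_of_inner_eq_zero (Subtype.mem _)
      intro w hw
      rw [inner_sub_left, adjoint_inner_left, sub_eq_zero]
      have := adjoint_inner_left (Ar i) ⟨w, hw⟩ h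
      rw [Submodule.coe_inner, Submodule.coe_inner, hAr] at this
      exact this.symm
    rw [← T_Q A Ω he, ← e, ← ih]
    refine Finset.sum_congr rfl fun α _ => ?_
    have : (List.ofFn fun k => Ar ((Fin.consEquiv fun _ => Fin d) (i, α) k)).prod
      = Ar i ∘L (List.ofFn fun k => Ar (α k)).prod := by
      simp [Fin.consEquiv, List.ofFn_succ]; rfl
    rw [this, adjoint_comp]; rfl

lemma bound {d : ℕ} (A : Fin d → H →L[ℂ] H) (Ω : H)
    (hco : ∑ i, A i ∘L adjoint (A i) = 1)
    (y : H →L[ℂ] H) (hy : Z A y = y) (hΩ : ⟪y Ω, Ω⟫_ℂ = 0) (n : ℕ) (h k : H) :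
    ‖⟪y h, k⟫_ℂ‖ ≤ ‖y‖ * (√((⟪T A Ω n h, h⟫_ℂ).re) * ‖k‖ + ‖h‖ * √((⟪T A Ω n k, k⟫_ℂ).re)) := by
  induction n generalizing h k with
  | zero =>
    rw [T, norm_Q_sq, norm_Q_sq, Real.sqrt_sq (norm_nonneg _), Real.sqrt_sq (norm_nonneg _)]
    obtain ⟨a, ha⟩ := sub_Q Ω h
    obtain ⟨b, hb⟩ := sub_Q Ω k
    have hle : ‖a • Ω‖ ≤ ‖h‖ := by
      have : a • Ω = (Submodule.span ℂ {Ω}).starProjection h := by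
        have h2 := Submodule.starProjection_add_starProjection_orthogonal
          (K := Submodule.span ℂ {Ω}) h
        apply add_left_cancel (a := (Submodule.span ℂ {Ω})ᗮ.starProjection h)
        rw [← ha, add_comm, h2]
      rw [this]
      exact Submodule.norm_starProjection_apply_le _ _
    set q := (Submodule.span ℂ {Ω})ᗮ.starProjection h
    set r := (Submodule.span ℂ {Ω})ᗮ.starProjection k
    have e : ⟪y h, k⟫_ℂ = ⟪y q, k⟫_ℂ + ⟪y (a • Ω), r⟫_ℂ := by
      have e1 : ⟪y h, k⟫_ℂ = ⟪y q, k⟫_ℂ + ⟪y (a • Ω), k⟫_ℂ := by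
        rw [← inner_add_left, ← map_add, ← ha]
      have e2 : ⟪y (a • Ω), k⟫_ℂ = ⟪y (a • Ω), r⟫_ℂ + ⟪y (a • Ω), b • Ω⟫_ℂ := by
        rw [← inner_add_right, ← hb]
      have e3 : ⟪y (a • Ω), b • Ω⟫_ℂ = 0 := by
        rw [map_smul, inner_smul_left, inner_smul_right, hΩ]; simp
      rw [e1, e2, e3, add_zero]
    rw [e]
    have i1 : ‖⟪y q, k⟫_ℂ‖ ≤ ‖y‖ * ‖q‖ * ‖k‖ :=
      (norm_inner_le_norm _ _).trans (by gcongr; exact y.le_opNorm q)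
    have i2 : ‖⟪y (a • Ω), r⟫_ℂ‖ ≤ ‖y‖ * ‖h‖ * ‖r‖ :=
      (norm_inner_le_norm _ _).trans (by
        gcongr
        exact (y.le_opNorm _).trans (by gcongr))
    calc _ ≤ _ := norm_add_le _ _
      _ ≤ _ := add_le_add i1 i2
      _ = _ := by ring
  | succ n ih =>
    have cs : ∀ u v : H, ∑ i, √((⟪T A Ω n (adjoint (A i) u), adjoint (A i) u⟫_ℂ).re)
        * ‖adjoint (A i) v‖ ≤ √((⟪T A Ω (n+1) u, u⟫_ℂ).re) * ‖v‖ := by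
      intro u v
      rw [T, inner_Z, Complex.re_sum]
      have := Real.sum_sqrt_mul_sqrt_le Finset.univ
        (f := fun i => (⟪T A Ω n (adjoint (A i) u), adjoint (A i) u⟫_ℂ).re)
        (g := fun i => ‖adjoint (A i) v‖ ^ 2)
        (fun i => (T_pos A Ω n).re_inner_nonneg_left _) (fun i => by positivity)
      rw [sum_norm A hco] at this
      simpa only [Real.sqrt_sq (norm_nonneg _)] using this
    have e : ⟪y h, k⟫_ℂ = ∑ i, ⟪y (adjoint (A i) h), adjoint (A i) k⟫_ℂ := by
      rw [← inner_Z, hy]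
    rw [e]
    calc _ ≤ _ := norm_sum_le _ _
      _ ≤ _ := Finset.sum_le_sum fun i _ => ih _ _
      _ = ‖y‖ * (∑ i, √((⟪T A Ω n (adjoint (A i) h), adjoint (A i) h⟫_ℂ).re)
        * ‖adjoint (A i) k‖ + ∑ i, √((⟪T A Ω n (adjoint (A i) k), adjoint (A i) k⟫_ℂ).re)
        * ‖adjoint (A i) h‖) := by
          rw [← Finset.mul_sum, Finset.sum_add_distrib]
          simp only [mul_comm ‖adjoint (A _) h‖]
      _ ≤ ‖y‖ * (√((⟪T A Ω (n+1) h, h⟫_ℂ).re) * ‖k‖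
          + √((⟪T A Ω (n+1) k, k⟫_ℂ).re) * ‖h‖) := by
          gcongr ‖y‖ * (?_ + ?_)
          · exact cs h k
          · exact cs k h
      _ = _ := by ring

end
end ErgStab

/-- `A` is ergodic with common eigenvector `Ω` for the adjoints iff
`H° = {Ω}ᗮ` is invariant for the `A i` and the restricted tuple on `H°` is `*`-stable. -/
theorem ergodic_iff_restriction_star_stable
    {H : Type*} [NormedAddCommGroup H] [InnerProductSpace ℂ H] [CompleteSpace H]
    (d : ℕ) (hd : 2 ≤ d) (A : Fin d → H →L[ℂ] H)
    (hco : ∑ i, A i ∘L ContinuousLinearMap.adjoint (A i) = 1)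
    (Ω : H) (hΩ : ‖Ω‖ = 1) :
    ((∀ x : H →L[ℂ] H,
        (∑ i, A i ∘L x ∘L ContinuousLinearMap.adjoint (A i)) = x → ∃ c : ℂ, x = c • 1) ∧
      (∀ i, ∃ c : ℂ, ContinuousLinearMap.adjoint (A i) Ω = c • Ω)) ↔
    ((∀ i, ∀ h ∈ (Submodule.span ℂ {Ω})ᗮ, A i h ∈ (Submodule.span ℂ {Ω})ᗮ) ∧
      (∀ Ar : Fin d → ((Submodule.span ℂ {Ω})ᗮ : Submodule ℂ H) →L[ℂ] ((Submodule.span ℂ {Ω})ᗮ : Submodule ℂ H),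
        (∀ (i : Fin d) (h : ((Submodule.span ℂ {Ω})ᗮ : Submodule ℂ H)), (Ar i h : H) = A i (h : H)) →
        ∀ h : ((Submodule.span ℂ {Ω})ᗮ : Submodule ℂ H),
          Filter.Tendsto
            (fun n : ℕ => ∑ α : Fin n → Fin d,
              ‖ContinuousLinearMap.adjoint
                ((List.ofFn fun k => Ar (α k)).prod) h‖ ^ 2)
            Filter.atTop (nhds 0))) := by
  have hΩ0 : ⟪Ω, Ω⟫_ℂ = 1 := by rw [inner_self_eq_norm_sq_to_K, hΩ]; simp
  have hΩne : Ω ≠ 0 := by rintro rfl; simp at hΩ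
  constructor
  · rintro ⟨herg, he⟩
    refine ⟨fun i h hh => ?_, fun Ar hAr h => ?_⟩
    · rw [Submodule.mem_orthogonal_singleton_iff_inner_right] at hh ⊢
      obtain ⟨c, hc⟩ := he i
      rw [← ContinuousLinearMap.adjoint_inner_left, hc, inner_smul_left, hh, mul_zero]
    · obtain ⟨L, hL⟩ := ErgStab.exists_lim (ErgStab.T A Ω) (ErgStab.T_pos A Ω)
        (ErgStab.one_sub_T A Ω) (ErgStab.T_step A Ω hco he)
      have hZ : ErgStab.Z A L = L := by
        ext k
        refine tendsto_nhds_unique ?_ ((Filter.tendsto_add_atTop_iff_nat 1).2 (hL k))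
        simp only [ErgStab.T, ErgStab.Z_apply]
        exact tendsto_finsetSum _ fun i _ => ((A i).continuous.tendsto _).comp (hL _)
      obtain ⟨c, hc⟩ := herg L hZ
      have hLΩ : L Ω = 0 := by
        refine tendsto_nhds_unique (hL Ω) ?_
        simp only [ErgStab.T_Ω A Ω he]
        exact tendsto_const_nhds
      have hc0 : c = 0 := by
        rw [hc] at hLΩ
        have : c • Ω = 0 := hLΩ
        exact (smul_eq_zero.1 this).resolve_right hΩne
      have hL0 : L = 0 := by rw [hc, hc0, zero_smul]
      simp only [ErgStab.sum_eq A Ω he Ar hAr]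
      have h1 := hL h
      rw [hL0] at h1
      have h2 := (Complex.continuous_re.tendsto _).comp
        (h1.inner (𝕜 := ℂ) (tendsto_const_nhds (x := (h : H))))
      simpa [Function.comp_def] using h2
  · rintro ⟨hinv, hst⟩
    have he : ∀ i, ∃ c : ℂ, ContinuousLinearMap.adjoint (A i) Ω = c • Ω := by
      intro i
      have : ContinuousLinearMap.adjoint (A i) Ω ∈ (Submodule.span ℂ {Ω})ᗮᗮ := by
        rw [Submodule.mem_orthogonal']
        intro u hu
        rw [ContinuousLinearMap.adjoint_inner_left]
        exact (Submodule.mem_orthogonal_singleton_iff_inner_right).1 (hinv i u hu)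
      rw [Submodule.orthogonal_orthogonal] at this
      obtain ⟨c, hc⟩ := Submodule.mem_span_singleton.1 this
      exact ⟨c, hc.symm⟩
    refine ⟨fun x hx => ?_, he⟩
    have hT0 : ∀ h : H, Filter.Tendsto (fun n => (⟪ErgStab.T A Ω n h, h⟫_ℂ).re)
        Filter.atTop (nhds 0) := by
      intro h
      obtain ⟨Ar, hAr⟩ : ∃ Ar : Fin d → ((Submodule.span ℂ {Ω})ᗮ : Submodule ℂ H) →L[ℂ]
          ((Submodule.span ℂ {Ω})ᗮ : Submodule ℂ H),
          ∀ (i : Fin d) (h : ((Submodule.span ℂ {Ω})ᗮ : Submodule ℂ H)),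
            (Ar i h : H) = A i (h : H) :=
        ⟨fun i => ((A i).comp (Submodule.subtypeL _)).codRestrict _
          (fun h => hinv i h h.2), fun i h => rfl⟩
      have := hst Ar hAr
        ⟨(Submodule.span ℂ {Ω})ᗮ.starProjection h, Submodule.starProjection_apply_mem _ _⟩
      simp only [ErgStab.sum_eq A Ω he Ar hAr] at this
      simpa only [ErgStab.T_Q A Ω he] using this
    have h1 : ErgStab.Z A 1 = 1 := hco
    obtain ⟨c, hc⟩ : ∃ c : ℂ, c = ⟪Ω, x Ω⟫_ℂ := ⟨_, rfl⟩
    have hZc : ErgStab.Z A (c • 1) = c • 1 := by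
      rw [← h1]
      ext k
      have h1k : ∀ k, ErgStab.Z A 1 k = k := fun k => by rw [h1]; rfl
      have h2 := h1k k
      rw [ErgStab.Z_apply] at h2
      rw [h1, ErgStab.Z_apply]
      simp only [smul_apply, map_smul, ← Finset.smul_sum]
      rw [h2]; rfl
    have hy : ErgStab.Z A (x - c • 1) = x - c • 1 := by
      rw [ErgStab.Z_sub, hZc]
      congr 1
    have hyΩ : ⟪(x - c • 1) Ω, Ω⟫_ℂ = 0 := by
      have : (x - c • 1) Ω = x Ω - c • Ω := rfl
      rw [this, inner_sub_left, inner_smul_left, hΩ0, hc, inner_conj_symm]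
      simp
    refine ⟨c, sub_eq_zero.1 ?_⟩
    refine ContinuousLinearMap.ext fun h => ext_inner_right ℂ fun k => ?_
    have hb := fun n => ErgStab.bound A Ω hco _ hy hyΩ n h k
    have hlim := (((hT0 h).sqrt.mul_const ‖k‖).add ((hT0 k).sqrt.const_mul ‖h‖)).const_mul
      ‖x - c • 1‖
    have := ge_of_tendsto' hlim hb
    simp only [Real.sqrt_zero, zero_mul, mul_zero, add_zero] at this
    rw [norm_le_zero_iff.1 this]
    simp
end

section
/- Set A_Ω := ∑_{i=1}^d conj(ω_i) A_i. Then (A_Ω*)ⁿ converges in the strong operator topology to the rank-one projection |Ω⟩⟨Ω|; that is, for every h ∈ H, (A_Ω*)ⁿ h → ⟨Ω, h⟩ Ω in norm as n → ∞. -/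
open scoped InnerProductSpace

section AuxLemmas

variable {H : Type*} [NormedAddCommGroup H] [InnerProductSpace ℂ H] [CompleteSpace H]

open ContinuousLinearMap Filter

lemma aux_re_mono_s3 {x y : H →L[ℂ] H} (h : x ≤ y) (v : H) :
    (⟪v, x v⟫_ℂ).re ≤ (⟪v, y v⟫_ℂ).re := by
  have := ((ContinuousLinearMap.le_def x y).1 h).re_inner_nonneg_right v
  simp only [ContinuousLinearMap.sub_apply, inner_sub_right, map_sub] at this
  simpa using this

lemma aux_sq_s3 {x : H →L[ℂ] H} (h0 : 0 ≤ x) (h1 : x ≤ 1) (v : H) :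
    ‖x v‖ ^ 2 ≤ (⟪v, x v⟫_ℂ).re := by
  have h2 : x ^ 2 ≤ x := by
    simpa using CStarAlgebra.pow_antitone h0 h1 one_le_two
  have h3 := aux_re_mono_s3 h2 v
  have hs : adjoint x = x := (IsSelfAdjoint.of_nonneg h0)
  have h4 : (⟪v, (x ^ 2) v⟫_ℂ) = ⟪x v, x v⟫_ℂ := by
    rw [pow_two, ContinuousLinearMap.mul_apply, ← ContinuousLinearMap.adjoint_inner_left, hs]
  rw [h4, inner_self_eq_norm_sq_to_K] at h3
  refine le_trans (le_of_eq ?_) h3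
  norm_cast

/-- A decreasing sequence of positive contractions converges strongly. -/
lemma aux_mono_lim (a : ℕ → H →L[ℂ] H) (h0 : ∀ n, 0 ≤ a n) (h1 : ∀ n, a n ≤ 1)
    (ha : Antitone a) : ∃ x : H →L[ℂ] H, ∀ v, Tendsto (fun n => a n v) atTop (nhds (x v)) := by
  have key : ∀ v, ∃ w, Tendsto (fun n => a n v) atTop (nhds w) := by
    intro v
    apply cauchySeq_tendsto_of_complete
    set s : ℕ → ℝ := fun n => (⟪v, a n v⟫_ℂ).re with hs
    have hsa : Antitone s := fun m n h => aux_re_mono_s3 (ha h) v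
    have hsb : BddBelow (Set.range s) := by
      refine ⟨0, ?_⟩
      rintro _ ⟨n, rfl⟩
      simpa using aux_re_mono_s3 (h0 n) v
    have hsc : CauchySeq s := (tendsto_atTop_ciInf hsa hsb).cauchySeq
    have hd : ∀ m n, m ≤ n → ‖a m v - a n v‖ ^ 2 ≤ s m - s n := by
      intro m n h
      have := aux_sq_s3 (x := a m - a n) (sub_nonneg.2 (ha h))
        ((sub_le_self _ (h0 n)).trans (h1 m)) v
      simpa [inner_sub_right] using this
    rw [Metric.cauchySeq_iff'] at hsc ⊢
    intro ε hε
    obtain ⟨N, hN⟩ := hsc (ε ^ 2) (by positivity)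
    refine ⟨N, fun n hn => ?_⟩
    have h2 := hN n hn
    rw [Real.dist_eq, abs_sub_comm] at h2
    have h3 := (hd N n hn).trans_lt ((le_abs_self _).trans_lt h2)
    rw [dist_comm, dist_eq_norm]
    exact lt_of_pow_lt_pow_left₀ 2 hε.le h3
  choose f hf using key
  exact ⟨continuousLinearMapOfTendsto a (tendsto_pi_nhds.2 hf), hf⟩

end AuxLemmas


/-- For an ergodic coisometric row contraction with eigenvector `Ω`,
the powers of the adjoint of `A_Ω := ∑ i, conj (ω i) • A i` converge strongly to the
rank-one projection `|Ω⟩⟨Ω|`. -/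
theorem adjoint_pow_tendsto_rankOne
    {H : Type*} [NormedAddCommGroup H] [InnerProductSpace ℂ H] [CompleteSpace H]
    (d : ℕ) (hd : 2 ≤ d) (A : Fin d → H →L[ℂ] H)
    (hco : ∑ i, A i ∘L ContinuousLinearMap.adjoint (A i) = 1)
    (hergodic : ∀ x : H →L[ℂ] H,
      (∑ i, A i ∘L x ∘L ContinuousLinearMap.adjoint (A i)) = x → ∃ c : ℂ, x = c • 1)
    (Ω : H) (hΩ : ‖Ω‖ = 1)
    (ω : Fin d → ℂ) (hω : ∑ i, ‖ω i‖ ^ 2 = 1)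
    (heig : ∀ i, ContinuousLinearMap.adjoint (A i) Ω = (starRingEnd ℂ) (ω i) • Ω)
    (AΩ : H →L[ℂ] H) (hAΩ : AΩ = ∑ i, (starRingEnd ℂ) (ω i) • A i) :
    ∀ h : H,
      Filter.Tendsto (fun n : ℕ => ((ContinuousLinearMap.adjoint AΩ) ^ n) h)
        Filter.atTop (nhds (⟪Ω, h⟫_ℂ • Ω)) := by
  classical
  set Z : (H →L[ℂ] H) → (H →L[ℂ] H) := fun x => ∑ i, A i * x * star (A i) with hZ
  have hZ1 : Z 1 = 1 := by
    simp only [hZ, mul_one]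
    exact hco
  have hZerg : ∀ x, Z x = x → ∃ c : ℂ, x = c • 1 := by
    intro x hx
    apply hergodic x
    rw [← hx]
    simp only [hZ, mul_assoc] at hx ⊢
    rw [hx]
    exact hx
  have hZmono : Monotone Z := by
    intro x y h
    refine Finset.sum_le_sum fun i _ => ?_
    simpa using star_left_conjugate_le_conjugate h (star (A i))
  have hZ0 : Z 0 = 0 := by simp [hZ]
  set T := ContinuousLinearMap.adjoint AΩ with hT
  have hT' : T = ∑ i, ω i • star (A i) := by
    rw [hT, hAΩ, ← ContinuousLinearMap.star_eq_adjoint]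
    simp [star_sum]
  have hTs : star T = ∑ i, (starRingEnd ℂ) (ω i) • A i := by
    rw [hT, ← hAΩ, ← ContinuousLinearMap.star_eq_adjoint, star_star]
  have hωc : ∑ i, ω i * (starRingEnd ℂ) (ω i) = 1 := by
    have := congrArg (fun r : ℝ => (r : ℂ)) hω
    simpa [Complex.mul_conj'] using this
  -- Kadison-Schwarz type inequality
  have hKS : ∀ x, 0 ≤ x → star T * x * T ≤ Z x := by
    intro x hx
    rw [← sub_nonneg]
    have h1 : 0 ≤ ∑ i, star (star (A i) - (starRingEnd ℂ) (ω i) • T) * x *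
        (star (A i) - (starRingEnd ℂ) (ω i) • T) :=
      Finset.sum_nonneg fun i _ => star_left_conjugate_nonneg hx _
    refine h1.trans (le_of_eq ?_)
    have h2 : ∀ i, star (star (A i) - (starRingEnd ℂ) (ω i) • T) * x *
        (star (A i) - (starRingEnd ℂ) (ω i) • T) =
        A i * x * star (A i) - ((starRingEnd ℂ) (ω i) • A i) * (x * T)
          - (star T * x) * (ω i • star (A i))
          + (ω i * (starRingEnd ℂ) (ω i)) • (star T * x * T) := by
      intro i
      simp only [star_sub, star_star, star_smul, sub_mul, mul_sub, smul_mul_assoc,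
        mul_smul_comm, mul_assoc, smul_sub, smul_smul, RCLike.star_def, Complex.conj_conj]
      rw [mul_comm (ω i)]
      abel
    simp only [h2, Finset.sum_add_distrib, Finset.sum_sub_distrib, ← Finset.sum_mul,
      ← Finset.mul_sum, ← Finset.sum_smul, hωc, ← hTs, ← hT']
    simp only [hZ, mul_assoc, one_smul]
    abel
  have hTT : star T * T ≤ 1 := by
    have := hKS 1 zero_le_one
    rwa [hZ1, mul_one] at this
  have hTn : ‖T‖ ≤ 1 := by
    have h1 := (CStarAlgebra.norm_le_one_iff_of_nonneg (star T * T) (star_mul_self_nonneg T)).2 hTT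
    rw [CStarRing.norm_star_mul_self] at h1
    nlinarith [norm_nonneg T]
  have hTΩ : T Ω = Ω := by
    rw [hT']
    simp only [ContinuousLinearMap.sum_apply, ContinuousLinearMap.smul_apply,
      ContinuousLinearMap.star_eq_adjoint, heig, smul_smul, ← Finset.sum_smul, hωc, one_smul]
  have hAΩΩ : AΩ Ω = Ω := by
    have h1 : ‖AΩ Ω‖ ≤ 1 := by
      have h2 : ‖AΩ‖ ≤ 1 := by
        rw [hT, LinearIsometryEquiv.norm_map] at hTn
        exact hTn
      calc ‖AΩ Ω‖ ≤ ‖AΩ‖ * ‖Ω‖ := AΩ.le_opNorm Ω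
        _ ≤ 1 := by rw [hΩ, mul_one]; exact h2
    have h3 : ⟪AΩ Ω, Ω⟫_ℂ = 1 := by
      rw [← ContinuousLinearMap.adjoint_inner_right, ← hT, hTΩ, inner_self_eq_norm_sq_to_K, hΩ]
      simp
    have h4 := @norm_sub_sq ℂ H _ _ _ (AΩ Ω) Ω
    rw [h3, hΩ] at h4
    simp only [RCLike.one_re] at h4
    have h5 : ‖AΩ Ω - Ω‖ = 0 := by
      have : ‖AΩ Ω - Ω‖ ^ 2 ≤ 0 := by nlinarith [norm_nonneg (AΩ Ω)]
      exact pow_eq_zero_iff two_ne_zero |>.1 (le_antisymm this (sq_nonneg _))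
    exact sub_eq_zero.1 (norm_eq_zero.1 h5)
  have hinv : ∀ (n : ℕ) (h : H), ⟪Ω, (T ^ n) h⟫_ℂ = ⟪Ω, h⟫_ℂ := by
    intro n
    induction n with
    | zero => intro h; simp
    | succ k ih =>
      intro h
      rw [pow_succ, ContinuousLinearMap.mul_apply, ih, hT,
        ContinuousLinearMap.adjoint_inner_right, hAΩΩ]
  set p : H →L[ℂ] H := InnerProductSpace.rankOne ℂ Ω Ω with hp
  have hpP : IsStarProjection p := InnerProductSpace.isStarProjection_rankOne_self hΩ
  set q : H →L[ℂ] H := 1 - p with hq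
  have hqP : IsStarProjection q := hpP.one_sub
  have hqq : q * q = q := hqP.isIdempotentElem
  have hqs : star q = q := hqP.isSelfAdjoint
  have hq0 : 0 ≤ q := by
    have := star_mul_self_nonneg q
    rwa [hqs, hqq] at this
  have hp0 : 0 ≤ p := by
    have := star_mul_self_nonneg p
    rwa [hpP.isSelfAdjoint.star_eq, hpP.isIdempotentElem.eq] at this
  have hq1 : q ≤ 1 := sub_le_self _ hp0
  have hqΩ : q Ω = 0 := by
    simp [hq, hp, inner_self_eq_norm_sq_to_K, hΩ]
  have hqA : ∀ i, q * star (A i) = q * star (A i) * q := by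
    intro i
    ext v
    have : v = q v + ⟪Ω, v⟫_ℂ • Ω := by simp [hq, hp]
    conv_lhs => rw [this]
    simp [ContinuousLinearMap.star_eq_adjoint, heig, hqΩ]
  have hAq : ∀ i, A i * q = q * (A i * q) := by
    intro i
    have := congrArg star (hqA i)
    simpa [hqs, mul_assoc] using this
  have hZq : Z q ≤ q := by
    have h1 : Z q = star q * Z q * q := by
      simp only [hZ, Finset.mul_sum, Finset.sum_mul, hqs]
      refine Finset.sum_congr rfl fun i _ => ?_
      calc A i * q * star (A i) = (A i * q) * (q * star (A i)) := by
            rw [mul_assoc, mul_assoc, ← mul_assoc q q, hqq]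
        _ = (q * (A i * q)) * (q * star (A i) * q) := by rw [← hAq, ← hqA]
        _ = q * (A i * (q * q) * star (A i)) * q := by simp only [mul_assoc]
        _ = _ := by rw [hqq]
    have h2 := star_left_conjugate_le_conjugate (hZmono hq1) q
    rw [← h1, hZ1, mul_one, hqs, hqq] at h2
    exact h2
  set a : ℕ → H →L[ℂ] H := fun n => Z^[n] q with ha
  have hasucc : ∀ n, a (n + 1) = Z (a n) := fun n => Function.iterate_succ_apply' Z n q
  have ha0 : ∀ n, 0 ≤ a n := by
    intro n
    induction n with
    | zero => exact hq0
    | succ k ih => rw [hasucc, ← hZ0]; exact hZmono ih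
  have haanti : Antitone a := by
    refine antitone_nat_of_succ_le fun n => ?_
    induction n with
    | zero => exact hZq
    | succ k ih => exact (hasucc (k + 1)).le.trans ((hZmono ih).trans (hasucc k).ge)
  have ha1 : ∀ n, a n ≤ 1 := fun n => (haanti (Nat.zero_le n)).trans hq1
  obtain ⟨x, hx⟩ := aux_mono_lim a ha0 ha1 haanti
  have hZx : Z x = x := by
    ext v
    have h1 : Filter.Tendsto (fun n => a (n + 1) v) Filter.atTop (nhds (Z x v)) := by
      simp only [hasucc, hZ, ContinuousLinearMap.sum_apply, ContinuousLinearMap.mul_apply]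
      exact tendsto_finsetSum _ fun i _ => ((A i).continuous.tendsto _).comp (hx _)
    exact tendsto_nhds_unique h1 ((Filter.tendsto_add_atTop_iff_nat 1).2 (hx v))
  have haΩ : ∀ n, ⟪Ω, a n Ω⟫_ℂ = 0 := by
    intro n
    induction n with
    | zero => simp [ha, hqΩ]
    | succ k ih =>
      rw [hasucc]
      simp only [hZ, ContinuousLinearMap.sum_apply, ContinuousLinearMap.mul_apply, inner_sum]
      refine Finset.sum_eq_zero fun i _ => ?_
      rw [← ContinuousLinearMap.adjoint_inner_left, ContinuousLinearMap.star_eq_adjoint, heig,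
        map_smul, inner_smul_left, inner_smul_right, ih]
      simp
  have hx0 : x = 0 := by
    obtain ⟨c, hc⟩ := hZerg x hZx
    have h1 : Filter.Tendsto (fun n => ⟪Ω, a n Ω⟫_ℂ) Filter.atTop (nhds ⟪Ω, x Ω⟫_ℂ) :=
      Filter.Tendsto.inner tendsto_const_nhds (hx Ω)
    simp only [haΩ] at h1
    have h2 := tendsto_nhds_unique h1 tendsto_const_nhds
    rw [hc] at h2
    simp [inner_smul_right, inner_self_eq_norm_sq_to_K, hΩ] at h2
    rw [hc, h2, zero_smul]
  have hdom : ∀ n, star (T ^ n) * q * T ^ n ≤ a n := by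
    intro n
    induction n with
    | zero => simp [ha]
    | succ k ih =>
      rw [hasucc]
      refine le_trans (le_of_eq ?_)
        ((star_left_conjugate_le_conjugate ih T).trans (hKS _ (ha0 k)))
      simp only [pow_succ, star_mul, mul_assoc]
  intro h
  have hb : ∀ n, ‖q ((T ^ n) h)‖ ^ 2 ≤ (⟪h, a n h⟫_ℂ).re := by
    intro n
    refine (aux_sq_s3 hq0 hq1 _).trans ?_
    have := aux_re_mono_s3 (hdom n) h
    rwa [ContinuousLinearMap.mul_apply, ContinuousLinearMap.mul_apply,
      ContinuousLinearMap.star_eq_adjoint, ContinuousLinearMap.adjoint_inner_right] at this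
  have hlim : Filter.Tendsto (fun n => (⟪h, a n h⟫_ℂ).re) Filter.atTop (nhds 0) := by
    have h1 : Filter.Tendsto (fun n => ⟪h, a n h⟫_ℂ) Filter.atTop (nhds ⟪h, x h⟫_ℂ) :=
      Filter.Tendsto.inner tendsto_const_nhds (hx h)
    have h2 := (Complex.continuous_re.tendsto _).comp h1
    simpa [hx0, Function.comp_def] using h2
  have hsq := squeeze_zero (fun n => sq_nonneg _) hb hlim
  have hnorm : Filter.Tendsto (fun n => ‖q ((T ^ n) h)‖) Filter.atTop (nhds 0) := by
    have := hsq.sqrt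
    simpa using this
  rw [tendsto_iff_norm_sub_tendsto_zero]
  refine hnorm.congr fun n => ?_
  congr 1
  rw [← hinv n h]
  simp [hq, hp]
end

section
/- Suppose A is coisometric. Then the following are equivalent: (1) the tuple A is ergodic (every x ∈ B(H) with ∑_i A_i x A_i* = x is a scalar multiple of the identity) and A_i*Ω = conj(ω_i)Ω for all i; (2) the tuple V is ergodic (every y ∈ B(K) with ∑_i V_i y V_i* = y is a scalar multiple of the identity) and V_i*(ιΩ) = conj(ω_i)(ιΩ) for all i. -/
open scoped InnerProductSpace

open Filter Topology ContinuousLinearMap in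
theorem aux_wot {K : Type*} [NormedAddCommGroup K] [InnerProductSpace ℂ K] [CompleteSpace K]
    (U : Ultrafilter ℕ) (T : ℕ → K →L[ℂ] K) (C : ℝ) (hT : ∀ n, ‖T n‖ ≤ C) :
    ∃ y : K →L[ℂ] K, ∀ u v : K,
      Tendsto (fun n => ⟪T n u, v⟫_ℂ) (U : Filter ℕ) (𝓝 ⟪y u, v⟫_ℂ) := by
  have hb : ∀ (u v : K) n, ‖⟪T n u, v⟫_ℂ‖ ≤ C * ‖u‖ * ‖v‖ := fun u v n =>
    (norm_inner_le_norm _ _).trans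
      (mul_le_mul_of_nonneg_right ((T n).le_of_opNorm_le (hT n) u) (norm_nonneg _))
  have key : ∀ u v : K, ∃ l : ℂ, ‖l‖ ≤ C * ‖u‖ * ‖v‖ ∧
      Tendsto (fun n => ⟪T n u, v⟫_ℂ) (U : Filter ℕ) (𝓝 l) := by
    intro u v
    have hc := isCompact_closedBall (0 : ℂ) (C * ‖u‖ * ‖v‖)
    obtain ⟨l, hl, hle⟩ := hc.ultrafilter_le_nhds (U.map (fun n => ⟪T n u, v⟫_ℂ)) (by
      rw [le_principal_iff]
      refine Filter.mem_map.2 (Filter.univ_mem' fun n => ?_)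
      simpa using hb u v n)
    exact ⟨l, by simpa using hl, hle⟩
  choose L hL1 hL2 using key
  let B0 : K →ₗ⋆[ℂ] K →ₗ[ℂ] ℂ := LinearMap.mk₂'ₛₗ (starRingEnd ℂ) (RingHom.id ℂ) L
    (fun u u' v => tendsto_nhds_unique (hL2 (u + u') v) (by
      simpa [inner_add_left] using (hL2 u v).add (hL2 u' v)))
    (fun c u v => tendsto_nhds_unique (hL2 (c • u) v) (by
      simpa [inner_smul_left, mul_comm] using (hL2 u v).const_mul (starRingEnd ℂ c)))
    (fun u v v' => tendsto_nhds_unique (hL2 u (v + v')) (by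
      simpa [inner_add_right] using (hL2 u v).add (hL2 u v')))
    (fun c u v => tendsto_nhds_unique (hL2 u (c • v)) (by
      simpa [inner_smul_right] using (hL2 u v).const_mul c))
  let B : K →L⋆[ℂ] K →L[ℂ] ℂ := B0.mkContinuous₂ C hL1
  refine ⟨InnerProductSpace.continuousLinearMapOfBilin B, fun u v => ?_⟩
  rw [InnerProductSpace.continuousLinearMapOfBilin_apply]
  exact hL2 u v

theorem aux_norm {K : Type*} [NormedAddCommGroup K] [InnerProductSpace ℂ K] [CompleteSpace K]
    {d : ℕ} (V : Fin d → K →L[ℂ] K)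
    (hV : ∀ i j v, ContinuousLinearMap.adjoint (V i) (V j v) = if i = j then v else 0)
    (w : Fin d → K) : ‖∑ i, V i (w i)‖ ^ 2 = ∑ i, ‖w i‖ ^ 2 := by
  have h : ⟪∑ i, V i (w i), ∑ i, V i (w i)⟫_ℂ = ∑ i, ⟪w i, w i⟫_ℂ := by
    rw [sum_inner]
    refine Finset.sum_congr rfl fun i _ => ?_
    rw [← ContinuousLinearMap.adjoint_inner_right]
    simp [map_sum, hV]
  simp only [inner_self_eq_norm_sq_to_K] at h
  exact_mod_cast h

theorem aux_bessel {K : Type*} [NormedAddCommGroup K] [InnerProductSpace ℂ K] [CompleteSpace K]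
    {d : ℕ} (V : Fin d → K →L[ℂ] K)
    (hV : ∀ i j v, ContinuousLinearMap.adjoint (V i) (V j v) = if i = j then v else 0)
    (v : K) : ∑ i, ‖ContinuousLinearMap.adjoint (V i) v‖ ^ 2 ≤ ‖v‖ ^ 2 := by
  set P := ∑ i, V i (ContinuousLinearMap.adjoint (V i) v) with hP
  have h1 : ‖P‖ ^ 2 = ∑ i, ‖ContinuousLinearMap.adjoint (V i) v‖ ^ 2 := aux_norm V hV _
  have h2 : ⟪v, P⟫_ℂ = ((‖P‖ ^ 2 : ℝ) : ℂ) := by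
    rw [h1, hP, inner_sum]
    push_cast
    refine Finset.sum_congr rfl fun i _ => ?_
    rw [← ContinuousLinearMap.adjoint_inner_left, inner_self_eq_norm_sq_to_K]
    rfl
  have h3 : ‖P‖ ^ 2 ≤ ‖v‖ * ‖P‖ := by
    have := norm_inner_le_norm (𝕜 := ℂ) v P
    rw [h2, Complex.norm_real, Real.norm_of_nonneg (by positivity)] at this
    exact this
  rw [← h1]
  nlinarith [norm_nonneg P, norm_nonneg v, sq_nonneg (‖v‖ - ‖P‖)]

theorem aux_contr {K : Type*} [NormedAddCommGroup K] [InnerProductSpace ℂ K] [CompleteSpace K]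
    {d : ℕ} (V : Fin d → K →L[ℂ] K)
    (hV : ∀ i j v, ContinuousLinearMap.adjoint (V i) (V j v) = if i = j then v else 0)
    (y : K →L[ℂ] K) : ‖∑ i, V i ∘L y ∘L ContinuousLinearMap.adjoint (V i)‖ ≤ ‖y‖ := by
  refine ContinuousLinearMap.opNorm_le_bound _ (norm_nonneg _) fun v => ?_
  refine le_of_sq_le_sq ?_ (by positivity)
  rw [_root_.sum_apply]
  simp only [ContinuousLinearMap.comp_apply]
  rw [aux_norm V hV, mul_pow]
  calc _ ≤ ∑ i, ‖y‖ ^ 2 * ‖ContinuousLinearMap.adjoint (V i) v‖ ^ 2 := by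
        refine Finset.sum_le_sum fun i _ => ?_
        rw [← mul_pow]
        gcongr
        exact y.le_opNorm _
    _ ≤ _ := by
        rw [← Finset.mul_sum]
        gcongr
        exact aux_bessel V hV v

open Filter Topology in
theorem aux_lift {H : Type*} [NormedAddCommGroup H] [InnerProductSpace ℂ H] [CompleteSpace H]
    {K : Type*} [NormedAddCommGroup K] [InnerProductSpace ℂ K] [CompleteSpace K]
    {d : ℕ} (A : Fin d → H →L[ℂ] H) (ι : H →ₗᵢ[ℂ] K) (V : Fin d → K →L[ℂ] K)
    (hV : ∀ i j v, ContinuousLinearMap.adjoint (V i) (V j v) = if i = j then v else 0)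
    (hdil : ∀ (i : Fin d) (h : H),
      ContinuousLinearMap.adjoint (V i) (ι h) = ι (ContinuousLinearMap.adjoint (A i) h))
    (x : H →L[ℂ] H) (hx : (∑ i, A i ∘L x ∘L ContinuousLinearMap.adjoint (A i)) = x) :
    ∃ y : K →L[ℂ] K, (∑ i, V i ∘L y ∘L ContinuousLinearMap.adjoint (V i)) = y ∧
      ∀ h k, ⟪y (ι h), ι k⟫_ℂ = ⟪x h, k⟫_ℂ := by
  let Φ : (K →L[ℂ] K) → (K →L[ℂ] K) :=
    fun y => ∑ i, V i ∘L y ∘L ContinuousLinearMap.adjoint (V i)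
  let J : H →L[ℂ] K := ι.toContinuousLinearMap
  let z : K →L[ℂ] K := J ∘L x ∘L ContinuousLinearMap.adjoint J
  let T : ℕ → K →L[ℂ] K := fun n => Φ^[n] z
  have hTs : ∀ n, T (n + 1) = Φ (T n) := fun n => Function.iterate_succ_apply' Φ n z
  have hΦ : ∀ (y : K →L[ℂ] K) u v, ⟪Φ y u, v⟫_ℂ = ∑ i,
      ⟪y (ContinuousLinearMap.adjoint (V i) u), ContinuousLinearMap.adjoint (V i) v⟫_ℂ := by
    intro y u v
    simp only [Φ, _root_.sum_apply, sum_inner, ContinuousLinearMap.comp_apply,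
      ContinuousLinearMap.adjoint_inner_right]
  have hTn : ∀ n, ‖T n‖ ≤ ‖z‖ := by
    intro n
    induction n with
    | zero => exact le_rfl
    | succ n ih => rw [hTs]; exact (aux_contr V hV _).trans ih
  have hTx : ∀ n h k, ⟪T n (ι h), ι k⟫_ℂ = ⟪x h, k⟫_ℂ := by
    intro n
    induction n with
    | zero =>
      intro h k
      have e : ContinuousLinearMap.adjoint J (ι h) = h := by
        refine ext_inner_right ℂ fun w => ?_
        rw [ContinuousLinearMap.adjoint_inner_left]
        exact ι.inner_map_map h w
      change ⟪ι (x (ContinuousLinearMap.adjoint J (ι h))), ι k⟫_ℂ = _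
      rw [e, ι.inner_map_map]
    | succ n ih =>
      intro h k
      rw [hTs, hΦ]
      simp only [hdil, ih]
      conv_rhs => rw [← hx]
      simp only [_root_.sum_apply, sum_inner, ContinuousLinearMap.comp_apply,
        ContinuousLinearMap.adjoint_inner_right]
  -- Cesaro means
  let S : ℕ → K →L[ℂ] K := fun N => ((N : ℂ) + 1)⁻¹ • ∑ n ∈ Finset.range (N + 1), T n
  have hpos : ∀ N : ℕ, ((N : ℂ) + 1) ≠ 0 := fun N => by exact_mod_cast Nat.succ_ne_zero N
  have hnorm : ∀ N : ℕ, ‖((N : ℂ) + 1)⁻¹‖ = ((N : ℝ) + 1)⁻¹ := fun N => by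
    rw [norm_inv]
    congr 1
    have : ((N : ℂ) + 1) = ((N + 1 : ℕ) : ℂ) := by push_cast; rfl
    rw [this, Complex.norm_natCast]; push_cast; rfl
  have hS : ∀ N, ‖S N‖ ≤ ‖z‖ := by
    intro N
    have h1 : ‖∑ n ∈ Finset.range (N + 1), T n‖ ≤ ((N : ℝ) + 1) * ‖z‖ := by
      refine (norm_sum_le_of_le _ fun n _ => hTn n).trans ?_
      simp
    calc ‖S N‖ = ((N : ℝ) + 1)⁻¹ * ‖∑ n ∈ Finset.range (N + 1), T n‖ := by
          simp only [S]; rw [norm_smul, hnorm]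
      _ ≤ ((N : ℝ) + 1)⁻¹ * (((N : ℝ) + 1) * ‖z‖) := by gcongr
      _ = ‖z‖ := by field_simp
  have hSi : ∀ N u v, ⟪S N u, v⟫_ℂ =
      ((N : ℂ) + 1)⁻¹ * ∑ n ∈ Finset.range (N + 1), ⟪T n u, v⟫_ℂ := by
    intro N u v
    simp [S, inner_smul_left, sum_inner, mul_comm]
  let U : Ultrafilter ℕ := Filter.hyperfilter ℕ
  have hU : (U : Filter ℕ) ≤ atTop := by
    rw [← Nat.cofinite_eq_atTop]; exact Filter.hyperfilter_le_cofinite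
  obtain ⟨y, hy⟩ := aux_wot U S ‖z‖ hS
  refine ⟨y, ?_, fun h k => ?_⟩
  · change Φ y = y
    refine ContinuousLinearMap.ext fun u => ext_inner_right ℂ fun v => ?_
    have h1 : Tendsto (fun N => ∑ i, ⟪S N (ContinuousLinearMap.adjoint (V i) u),
        ContinuousLinearMap.adjoint (V i) v⟫_ℂ) (U : Filter ℕ) (𝓝 ⟪Φ y u, v⟫_ℂ) := by
      rw [hΦ]
      exact tendsto_finsetSum _ fun i _ => hy _ _
    have h2 := h1.sub (hy u v)
    have h3 : Tendsto (fun N : ℕ => ((N : ℂ) + 1)⁻¹ * (⟪T (N + 1) u, v⟫_ℂ - ⟪T 0 u, v⟫_ℂ))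
        (U : Filter ℕ) (𝓝 0) := by
      refine Tendsto.mono_left ?_ hU
      refine squeeze_zero_norm (a := fun N : ℕ => 1 / ((N : ℝ) + 1) * (2 * (‖z‖ * ‖u‖ * ‖v‖)))
        (fun N => ?_) ?_
      · rw [norm_mul, hnorm, one_div]
        gcongr
        have hb : ∀ n, ‖⟪T n u, v⟫_ℂ‖ ≤ ‖z‖ * ‖u‖ * ‖v‖ := fun n =>
          (norm_inner_le_norm _ _).trans
            (mul_le_mul_of_nonneg_right ((T n).le_of_opNorm_le (hTn n) u) (norm_nonneg _))
        calc _ ≤ _ := norm_sub_le _ _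
          _ ≤ _ := by linarith [hb (N + 1), hb 0]
      · simpa using (tendsto_one_div_add_atTop_nhds_zero_nat (𝕜 := ℝ)).mul_const
          (2 * (‖z‖ * ‖u‖ * ‖v‖))
    have h4 := tendsto_nhds_unique (h2.congr fun N => ?_) h3
    · exact sub_eq_zero.1 h4
    · simp only [hSi]
      rw [← Finset.mul_sum, Finset.sum_comm]
      simp only [← hΦ, ← hTs]
      rw [← mul_sub, ← Finset.sum_sub_distrib, Finset.sum_range_sub (fun n => ⟪T n u, v⟫_ℂ)]
  · refine tendsto_nhds_unique (hy (ι h) (ι k)) ?_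
    refine tendsto_const_nhds.congr fun N => ?_
    rw [hSi]
    simp only [hTx]
    have := hpos N
    simp
    field_simp

theorem aux_zero {H : Type*} [NormedAddCommGroup H] [InnerProductSpace ℂ H] [CompleteSpace H]
    {K : Type*} [NormedAddCommGroup K] [InnerProductSpace ℂ K] [CompleteSpace K]
    {d : ℕ} (A : Fin d → H →L[ℂ] H) (ι : H →ₗᵢ[ℂ] K) (V : Fin d → K →L[ℂ] K)
    (hdil : ∀ (i : Fin d) (h : H),
      ContinuousLinearMap.adjoint (V i) (ι h) = ι (ContinuousLinearMap.adjoint (A i) h))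
    (hmin : Dense ((Submodule.span ℂ
      {k : K | ∃ (n : ℕ) (α : Fin n → Fin d) (h : H),
        k = (List.ofFn fun j => V (α j)).prod (ι h)} : Submodule ℂ K) : Set K))
    (z : K →L[ℂ] K) (hz1 : ∀ i v, z (V i v) = V i (z v))
    (hz2 : ∀ i v, ContinuousLinearMap.adjoint (V i) (z v) = z (ContinuousLinearMap.adjoint (V i) v))
    (hz : ∀ h k, ⟪z (ι h), ι k⟫_ℂ = 0) : z = 0 := by
  have h1 : ∀ (n : ℕ) (α : Fin n → Fin d) (h k : H),
      ⟪z (ι h), (List.ofFn fun j => V (α j)).prod (ι k)⟫_ℂ = 0 := by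
    intro n
    induction n with
    | zero => intro α h k; simpa using hz h k
    | succ n ih =>
      intro α h k
      rw [List.ofFn_succ, List.prod_cons]
      change ⟪z (ι h), V (α 0) ((List.ofFn fun j => V (α (Fin.succ j))).prod (ι k))⟫_ℂ = 0
      rw [← ContinuousLinearMap.adjoint_inner_left, hz2, hdil]
      exact ih (fun j => α j.succ) _ k
  have h2 : ∀ h, z (ι h) = 0 := by
    intro h
    have e : innerSL ℂ (z (ι h)) = 0 := by
      refine ContinuousLinearMap.ext_on hmin ?_
      rintro _ ⟨n, α, k, rfl⟩
      simpa using h1 n α h k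
    have := congrArg (fun f => f (z (ι h))) e
    simpa using this
  have h3 : ∀ (n : ℕ) (α : Fin n → Fin d) (h : H),
      z ((List.ofFn fun j => V (α j)).prod (ι h)) = 0 := by
    intro n
    induction n with
    | zero => intro α h; simpa using h2 h
    | succ n ih =>
      intro α h
      rw [List.ofFn_succ, List.prod_cons]
      change z (V (α 0) ((List.ofFn fun j => V (α (Fin.succ j))).prod (ι h))) = 0
      rw [hz1,
        ih (fun j => α j.succ), map_zero]
  refine ContinuousLinearMap.ext_on hmin ?_
  rintro _ ⟨n, α, k, rfl⟩
  simpa using h3 n α k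

/-- For a coisometric row contraction `A` with minimal isometric dilation
`V` on `K` (with isometric embedding `ι : H → K`): `A` is ergodic with `(A i)* Ω = conj (ω i) • Ω`
iff `V` is ergodic with `(V i)* (ι Ω) = conj (ω i) • (ι Ω)`. -/
theorem ergodic_dilation_iff
    {H : Type*} [NormedAddCommGroup H] [InnerProductSpace ℂ H] [CompleteSpace H]
    {K : Type*} [NormedAddCommGroup K] [InnerProductSpace ℂ K] [CompleteSpace K]
    (d : ℕ) (hd : 2 ≤ d) (A : Fin d → H →L[ℂ] H)
    (hco : ∑ i, A i ∘L ContinuousLinearMap.adjoint (A i) = 1)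
    (Ω : H) (hΩ : ‖Ω‖ = 1)
    (ω : Fin d → ℂ) (hω : ∑ i, ‖ω i‖ ^ 2 = 1)
    (ι : H →ₗᵢ[ℂ] K) (V : Fin d → K →L[ℂ] K)
    (hVorth : ∀ i j, ContinuousLinearMap.adjoint (V i) ∘L V j =
      if i = j then (1 : K →L[ℂ] K) else 0)
    (hdil : ∀ (i : Fin d) (h : H),
      ContinuousLinearMap.adjoint (V i) (ι h) = ι (ContinuousLinearMap.adjoint (A i) h))
    (hmin : Dense ((Submodule.span ℂ
      {k : K | ∃ (n : ℕ) (α : Fin n → Fin d) (h : H),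
        k = (List.ofFn fun j => V (α j)).prod (ι h)} : Submodule ℂ K) : Set K)) :
    ((∀ x : H →L[ℂ] H,
        (∑ i, A i ∘L x ∘L ContinuousLinearMap.adjoint (A i)) = x → ∃ c : ℂ, x = c • 1) ∧
      (∀ i, ContinuousLinearMap.adjoint (A i) Ω = (starRingEnd ℂ) (ω i) • Ω)) ↔
    ((∀ y : K →L[ℂ] K,
        (∑ i, V i ∘L y ∘L ContinuousLinearMap.adjoint (V i)) = y → ∃ c : ℂ, y = c • 1) ∧
      (∀ i, ContinuousLinearMap.adjoint (V i) (ι Ω) = (starRingEnd ℂ) (ω i) • (ι Ω))) := by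
  have hV : ∀ i j v, ContinuousLinearMap.adjoint (V i) (V j v) = if i = j then v else 0 := by
    intro i j v
    have := congrArg (fun f => f v) (hVorth i j)
    simp only [ContinuousLinearMap.comp_apply] at this
    rw [this]
    split_ifs <;> simp
  refine and_congr ⟨fun hA y hy => ?_, fun hVe x hx => ?_⟩ (forall_congr' fun i => ?_)
  · have hyv : ∀ v, y v = ∑ i, V i (y (ContinuousLinearMap.adjoint (V i) v)) := by
      intro v
      conv_lhs => rw [← hy]
      simp [_root_.sum_apply]
    have hy1 : ∀ i v, y (V i v) = V i (y v) := by
      intro i v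
      rw [hyv (V i v), Finset.sum_eq_single i]
      · rw [hV, if_pos rfl]
      · intro j _ hj; rw [hV, if_neg hj, map_zero, map_zero]
      · simp
    have hy2 : ∀ i v, ContinuousLinearMap.adjoint (V i) (y v) =
        y (ContinuousLinearMap.adjoint (V i) v) := by
      intro i v
      rw [hyv v, map_sum]
      simp [hV]
    let J : H →L[ℂ] K := ι.toContinuousLinearMap
    let x : H →L[ℂ] H := ContinuousLinearMap.adjoint J ∘L y ∘L J
    have hxi : ∀ h k, ⟪x h, k⟫_ℂ = ⟪y (ι h), ι k⟫_ℂ := by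
      intro h k
      change ⟪ContinuousLinearMap.adjoint J (y (ι h)), k⟫_ℂ = _
      rw [ContinuousLinearMap.adjoint_inner_left]
      rfl
    obtain ⟨c, hc⟩ := hA x (by
      refine ContinuousLinearMap.ext fun u => ext_inner_right ℂ fun v => ?_
      rw [hxi, hyv]
      simp only [_root_.sum_apply, sum_inner, ContinuousLinearMap.comp_apply]
      refine Finset.sum_congr rfl fun i _ => ?_
      rw [← ContinuousLinearMap.adjoint_inner_right, hxi,
        ← ContinuousLinearMap.adjoint_inner_right (V i), hdil, hdil])
    refine ⟨c, sub_eq_zero.1 (aux_zero A ι V hdil hmin _ ?_ ?_ ?_)⟩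
    · intro i v; simp [hy1]
    · intro i v; simp [hy2]
    · intro h k
      have := hxi h k
      rw [hc] at this
      simp only [_root_.sub_apply, inner_sub_left, ← this]
      simp [inner_smul_left, mul_comm]
  · obtain ⟨y, hy, hyx⟩ := aux_lift A ι V hV hdil x hx
    obtain ⟨c, rfl⟩ := hVe y hy
    refine ⟨c, ContinuousLinearMap.ext fun u => ext_inner_right ℂ fun v => ?_⟩
    rw [← hyx]
    simp [inner_smul_left, mul_comm]
  · rw [hdil, ← map_smul, ι.injective.eq_iff]
end

section
/- If in addition A is ergodic (every x ∈ B(H) with ∑_i A_i x A_i* = x is a scalar multiple of the identity) and A_i*Ω = conj(ω_i)Ω for all i, then ιΩ is a cyclic vector for the dilation: the linear span of {V_α(ιΩ) : α ∈ Λ̃} is dense in K. (In other words, V is also a minimal isometric dilation of the one-dimensional row contraction ω : ℂ^d → ℂ.) -/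
open scoped InnerProductSpace

/-- If `A` is an ergodic coisometric row contraction with
`(A i)* Ω = conj (ω i) • Ω`, then `ι Ω` is cyclic for a minimal isometric dilation `V`:
the span of `{V_α (ι Ω)}` is dense in `K`. -/
theorem dilation_cyclic_vector
    {H : Type*} [NormedAddCommGroup H] [InnerProductSpace ℂ H] [CompleteSpace H]
    {K : Type*} [NormedAddCommGroup K] [InnerProductSpace ℂ K] [CompleteSpace K]
    (d : ℕ) (hd : 2 ≤ d) (A : Fin d → H →L[ℂ] H)
    (hco : ∑ i, A i ∘L ContinuousLinearMap.adjoint (A i) = 1)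
    (hergodic : ∀ x : H →L[ℂ] H,
      (∑ i, A i ∘L x ∘L ContinuousLinearMap.adjoint (A i)) = x → ∃ c : ℂ, x = c • 1)
    (Ω : H) (hΩ : ‖Ω‖ = 1)
    (ω : Fin d → ℂ) (hω : ∑ i, ‖ω i‖ ^ 2 = 1)
    (heig : ∀ i, ContinuousLinearMap.adjoint (A i) Ω = (starRingEnd ℂ) (ω i) • Ω)
    (ι : H →ₗᵢ[ℂ] K) (V : Fin d → K →L[ℂ] K)
    (hVorth : ∀ i j, ContinuousLinearMap.adjoint (V i) ∘L V j =
      if i = j then (1 : K →L[ℂ] K) else 0)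
    (hdil : ∀ (i : Fin d) (h : H),
      ContinuousLinearMap.adjoint (V i) (ι h) = ι (ContinuousLinearMap.adjoint (A i) h))
    (hmin : Dense ((Submodule.span ℂ
      {k : K | ∃ (n : ℕ) (α : Fin n → Fin d) (h : H),
        k = (List.ofFn fun j => V (α j)).prod (ι h)} : Submodule ℂ K) : Set K)) :
    Dense ((Submodule.span ℂ
      {k : K | ∃ (n : ℕ) (α : Fin n → Fin d),
        k = (List.ofFn fun j => V (α j)).prod (ι Ω)} : Submodule ℂ K) : Set K) := by
  have hVO : ∀ i j k, ContinuousLinearMap.adjoint (V i) (V j k) = if i = j then k else 0 := by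
    intro i j k
    have := congrArg (fun T : K →L[ℂ] K => T k) (hVorth i j)
    simp only [ContinuousLinearMap.comp_apply] at this
    rw [this]; split_ifs <;> simp
  -- the Cuntz relation on the image of `ι`
  have hP : ∀ h, ∑ i, V i (ContinuousLinearMap.adjoint (V i) (ι h)) = ι h := by
    intro h
    set P := ∑ i, V i (ContinuousLinearMap.adjoint (V i) (ι h)) with hPdef
    have h1 : ∀ i, ContinuousLinearMap.adjoint (V i) (ι h - P) = 0 := by
      intro i
      simp [hPdef, map_sum, hVO]
    have h2 : inner ℂ P (ι h - P) = 0 := by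
      conv_lhs => rw [hPdef]
      rw [sum_inner]
      refine Finset.sum_eq_zero fun i _ => ?_
      rw [← ContinuousLinearMap.adjoint_inner_right, h1, inner_zero_right]
    have h3 : inner ℂ (ι h) (ι h - P) = 0 := by
      rw [inner_sub_right, hPdef, inner_sum]
      simp only [← ContinuousLinearMap.adjoint_inner_left, hdil, ι.inner_map_map]
      simp only [ContinuousLinearMap.adjoint_inner_left]
      rw [← inner_sum]
      have := congrArg (fun T : H →L[ℂ] H => T h) hco
      simp only [ContinuousLinearMap.sum_apply, ContinuousLinearMap.comp_apply] at this
      rw [this]; simp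
    have h4 : inner ℂ (ι h - P) (ι h - P) = 0 := by
      rw [inner_sub_left, h2, h3, sub_zero]
    exact (sub_eq_zero.1 (inner_self_eq_zero.1 h4)).symm
  set S : Submodule ℂ K := Submodule.span ℂ
      {k : K | ∃ (n : ℕ) (α : Fin n → Fin d),
        k = (List.ofFn fun j => V (α j)).prod (ι Ω)} with hS
  have hΩS : ι Ω ∈ S := Submodule.subset_span ⟨0, Fin.elim0, by simp⟩
  have hVS : ∀ i, ∀ k ∈ S, V i k ∈ S := by
    intro i k hk
    have : S ≤ S.comap (V i).toLinearMap := by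
      conv_lhs => rw [hS]
      rw [Submodule.span_le]
      rintro _ ⟨n, α, rfl⟩
      refine Submodule.subset_span ⟨n + 1, Fin.cons i α, ?_⟩
      simp [List.ofFn_succ]
    exact this hk
  have hVS' : ∀ i, ∀ k ∈ S, ContinuousLinearMap.adjoint (V i) k ∈ S := by
    intro i k hk
    have : S ≤ S.comap (ContinuousLinearMap.adjoint (V i)).toLinearMap := by
      conv_lhs => rw [hS]
      rw [Submodule.span_le]
      rintro _ ⟨n, α, rfl⟩
      rcases n with _ | n
      · simp only [List.ofFn_zero, List.prod_nil, Submodule.comap_coe, Set.mem_preimage,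
          ContinuousLinearMap.one_apply, ContinuousLinearMap.coe_coe, SetLike.mem_coe]
        rw [hdil, heig, map_smul]
        exact S.smul_mem _ hΩS
      · simp only [List.ofFn_succ, List.prod_cons, Submodule.comap_coe, Set.mem_preimage,
          ContinuousLinearMap.mul_apply, ContinuousLinearMap.coe_coe, SetLike.mem_coe, hVO]
        split_ifs
        · exact Submodule.subset_span ⟨n, fun j => α j.succ, rfl⟩
        · exact S.zero_mem
    exact this hk
  set M := S.topologicalClosure with hM
  have hSM : S ≤ M := S.le_topologicalClosure
  have hVM : ∀ i, ∀ k ∈ M, V i k ∈ M := fun i k hk =>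
    map_mem_closure (V i).continuous hk (hVS i)
  have hVM' : ∀ i, ∀ k ∈ M, ContinuousLinearMap.adjoint (V i) k ∈ M := fun i k hk =>
    map_mem_closure (ContinuousLinearMap.adjoint (V i)).continuous hk (hVS' i)
  haveI : CompleteSpace M := S.isClosed_topologicalClosure.completeSpace_coe
  have hcomm : ∀ i k, V i (M.starProjection k) = M.starProjection (V i k) := by
    intro i k
    refine (Submodule.eq_starProjection_of_mem_of_inner_eq_zero
      (hVM i _ (M.starProjection_apply_mem k)) ?_).symm
    intro w hw
    rw [← map_sub, ← ContinuousLinearMap.adjoint_inner_right]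
    exact Submodule.starProjection_inner_eq_zero k _ (hVM' i w hw)
  let J : H →L[ℂ] K := ι.toContinuousLinearMap
  obtain ⟨c, hc⟩ := hergodic (ContinuousLinearMap.adjoint J ∘L M.starProjection ∘L J) (by
    ext h
    refine ext_inner_left ℂ fun g => ?_
    simp only [ContinuousLinearMap.sum_apply, ContinuousLinearMap.comp_apply, inner_sum]
    simp only [← ContinuousLinearMap.adjoint_inner_left (A _)]
    simp only [ContinuousLinearMap.adjoint_inner_right]
    simp only [J, LinearIsometry.coe_toContinuousLinearMap, ← hdil]
    simp only [ContinuousLinearMap.adjoint_inner_left, hcomm]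
    rw [← inner_sum, ← map_sum, hP])
  have hc' : ∀ h, inner ℂ (ι h) (M.starProjection (ι h)) = c * inner ℂ h h := by
    intro h
    have := congrArg (fun T : H →L[ℂ] H => inner ℂ h (T h)) hc
    simpa [ContinuousLinearMap.adjoint_inner_right, J, inner_smul_right] using this
  have hc1 : c = 1 := by
    have := hc' Ω
    rw [Submodule.starProjection_eq_self_iff.2 (hSM hΩS), ι.inner_map_map,
      inner_self_eq_norm_sq_to_K, hΩ] at this
    simpa using this.symm
  have hιM : ∀ h, ι h ∈ M := by
    intro h
    have h1 := hc' h
    rw [hc1, one_mul, ← ι.inner_map_map] at h1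
    have h2 : inner ℂ (ι h - M.starProjection (ι h)) (M.starProjection (ι h)) = 0 :=
      Submodule.starProjection_inner_eq_zero _ _ (M.starProjection_apply_mem _)
    have h3 : inner ℂ (ι h - M.starProjection (ι h)) (ι h - M.starProjection (ι h)) = 0 := by
      rw [inner_sub_right, h2, inner_sub_left, ← inner_conj_symm (M.starProjection (ι h)), h1,
        inner_conj_symm]
      simp
    have h4 := sub_eq_zero.1 (inner_self_eq_zero.1 h3)
    rw [h4]; exact M.starProjection_apply_mem _
  have hle : Submodule.span ℂ
      {k : K | ∃ (n : ℕ) (α : Fin n → Fin d) (h : H),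
        k = (List.ofFn fun j => V (α j)).prod (ι h)} ≤ M := by
    rw [Submodule.span_le]
    rintro _ ⟨n, α, h, rfl⟩
    induction n with
    | zero => simpa using hιM h
    | succ n ih =>
      simp only [List.ofFn_succ, List.prod_cons, ContinuousLinearMap.mul_apply]
      exact hVM _ _ (ih _)
  have hMd : Dense (M : Set K) := hmin.mono hle
  rw [hM, Submodule.topologicalClosure_coe] at hMd
  exact dense_closure.1 hMd
end

section
/- The linear span of {A_α Ω : α ∈ Λ̃} is dense in H. -/
open scoped InnerProductSpace

lemma sod_re_le {H : Type*} [NormedAddCommGroup H] [InnerProductSpace ℂ H] [CompleteSpace H]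
    {S T : H →L[ℂ] H} (h : S ≤ T) (x : H) : (⟪S x, x⟫_ℂ).re ≤ (⟪T x, x⟫_ℂ).re := by
  have := ((ContinuousLinearMap.le_def S T).1 h).re_inner_nonneg_left x
  simp only [ContinuousLinearMap.sub_apply, inner_sub_left, map_sub] at this
  simpa using this

lemma sod_norm_sq_le {H : Type*} [NormedAddCommGroup H] [InnerProductSpace ℂ H] [CompleteSpace H]
    {S : H →L[ℂ] H} (h0 : 0 ≤ S) (h1 : S ≤ 1) (x : H) : ‖S x‖ ^ 2 ≤ (⟪S x, x⟫_ℂ).re := by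
  have h2 : S ^ 2 ≤ S := by simpa using CStarAlgebra.pow_antitone h0 h1 one_le_two
  have h3 := sod_re_le h2 x
  have h4 := ((ContinuousLinearMap.nonneg_iff_isPositive S).1 h0).inner_left_eq_inner_right (S x) x
  have h5 : (S ^ 2) x = S (S x) := by rw [pow_two]; rfl
  rw [h5, h4, inner_self_eq_norm_sq_to_K] at h3
  norm_cast at h3

lemma sod_limit {H : Type*} [NormedAddCommGroup H] [InnerProductSpace ℂ H] [CompleteSpace H]
    (T : ℕ → H →L[ℂ] H) (hT : Antitone T) (h0 : ∀ n, 0 ≤ T n) (h1 : ∀ n, T n ≤ 1) :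
    ∃ L : H →L[ℂ] H, ∀ x, Filter.Tendsto (fun n => T n x) Filter.atTop (nhds (L x)) := by
  have key : ∀ x, ∃ y, Filter.Tendsto (fun n => T n x) Filter.atTop (nhds y) := by
    intro x
    apply cauchySeq_tendsto_of_complete
    have hc : CauchySeq (fun n => (⟪T n x, x⟫_ℂ).re) := by
      have := tendsto_atTop_ciInf (f := fun n => (⟪T n x, x⟫_ℂ).re)
        (fun m n hmn => sod_re_le (hT hmn) x) ⟨0, by
          rintro _ ⟨n, rfl⟩
          simpa using sod_re_le (h0 n) x⟩
      exact this.cauchySeq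
    rw [Metric.cauchySeq_iff'] at hc ⊢
    intro ε hε
    obtain ⟨N, hN⟩ := hc (ε ^ 2) (by positivity)
    refine ⟨N, fun n hn => ?_⟩
    have h2 := hN n hn
    have h3 := sod_norm_sq_le (S := T N - T n) (sub_nonneg.2 (hT hn))
      ((sub_le_self _ (h0 n)).trans (h1 N)) x
    simp only [ContinuousLinearMap.sub_apply, inner_sub_left, Complex.sub_re] at h3
    rw [dist_comm, dist_eq_norm]
    rw [dist_comm, Real.dist_eq] at h2
    exact lt_of_pow_lt_pow_left₀ 2 hε.le (h3.trans_lt ((le_abs_self _).trans_lt h2))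
  choose f hf using key
  exact ⟨continuousLinearMapOfTendsto (fun n => T n) (tendsto_pi_nhds.2 hf), hf⟩

theorem span_orbit_dense
    {H : Type*} [NormedAddCommGroup H] [InnerProductSpace ℂ H] [CompleteSpace H]
    (d : ℕ) (hd : 2 ≤ d) (A : Fin d → H →L[ℂ] H)
    (hco : ∑ i, A i ∘L ContinuousLinearMap.adjoint (A i) = 1)
    (hergodic : ∀ x : H →L[ℂ] H,
      (∑ i, A i ∘L x ∘L ContinuousLinearMap.adjoint (A i)) = x → ∃ c : ℂ, x = c • 1)
    (Ω : H) (hΩ : ‖Ω‖ = 1)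
    (ω : Fin d → ℂ) (hω : ∑ i, ‖ω i‖ ^ 2 = 1)
    (heig : ∀ i, ContinuousLinearMap.adjoint (A i) Ω = (starRingEnd ℂ) (ω i) • Ω) :
    Dense ((Submodule.span ℂ
      {h : H | ∃ (n : ℕ) (α : Fin n → Fin d),
        h = (List.ofFn fun j => A (α j)).prod Ω} : Submodule ℂ H) : Set H) := by
  set M : Submodule ℂ H := Submodule.span ℂ
      {h : H | ∃ (n : ℕ) (α : Fin n → Fin d),
        h = (List.ofFn fun j => A (α j)).prod Ω} with hM
  have hMinv : ∀ i, ∀ x ∈ M, A i x ∈ M := by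
    intro i x hx
    have : M ≤ M.comap (A i : H →ₗ[ℂ] H) := by
      conv_lhs => rw [hM]
      rw [Submodule.span_le]
      rintro _ ⟨n, α, rfl⟩
      refine Submodule.subset_span ⟨n + 1, Fin.cons i α, ?_⟩
      simp [List.ofFn_succ]
    exact this hx
  set K := M.topologicalClosure with hK
  have hKinv : ∀ i, ∀ x ∈ K, A i x ∈ K := by
    intro i x hx
    exact map_mem_closure (A i).continuous hx (hMinv i)
  have hΩK : Ω ∈ K := M.le_topologicalClosure
    (Submodule.subset_span ⟨0, Fin.elim0, by simp⟩)
  haveI : CompleteSpace K := M.isClosed_topologicalClosure.completeSpace_coe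
  set P : H →L[ℂ] H := K.starProjection with hP
  have hPproj : IsStarProjection P := isStarProjection_starProjection
  have hP0 : 0 ≤ P := hPproj.nonneg
  have hP1 : P ≤ 1 := hPproj.le_one
  have hAP : ∀ i, P * (A i * P) = A i * P := by
    intro i
    ext x
    exact Submodule.starProjection_eq_self_iff.2 (hKinv i _ (Submodule.starProjection_apply_mem _ _))
  have hPA : ∀ i, P * star (A i) * P = P * star (A i) := by
    intro i
    have := congrArg star (hAP i)
    simpa [hPproj.isSelfAdjoint.star_eq] using this
  let Φ : (H →L[ℂ] H) → (H →L[ℂ] H) := fun x => ∑ i, A i * x * star (A i)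
  have hΦmono : Monotone Φ := fun x y hxy =>
    Finset.sum_le_sum fun i _ => star_right_conjugate_le_conjugate hxy (A i)
  have hΦ0 : Φ 0 = 0 := by simp [Φ]
  have hΦ1 : Φ 1 = 1 := by
    simp only [Φ, mul_one]
    exact hco
  have hΦP : Φ P ≤ P := by
    have e : Φ P = P * Φ P * star P := by
      simp only [Φ, Finset.mul_sum, Finset.sum_mul, hPproj.isSelfAdjoint.star_eq]
      refine Finset.sum_congr rfl fun i _ => ?_
      calc A i * P * star (A i) = P * (A i * P) * star (A i) := by rw [hAP]
        _ = P * A i * (P * star (A i)) := by simp only [mul_assoc]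
        _ = P * A i * (P * star (A i) * P) := by rw [hPA]
        _ = _ := by simp only [mul_assoc]
    rw [e]
    have h1 : Φ P ≤ 1 := (hΦmono hP1).trans hΦ1.le
    refine (star_right_conjugate_le_conjugate h1 P).trans ?_
    rw [mul_one, hPproj.isSelfAdjoint.star_eq, hPproj.isIdempotentElem.eq]
  let T : ℕ → H →L[ℂ] H := fun n => Φ^[n] P
  have hTs : ∀ n, T (n + 1) = Φ (T n) := fun n => Function.iterate_succ_apply' Φ n P
  have hTanti : Antitone T := by
    apply antitone_nat_of_succ_le
    intro n
    induction n with
    | zero => simpa [T] using hΦP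
    | succ n ih => rw [hTs (n + 1)]; exact (hΦmono ih).trans (hTs n).ge
  have hT0 : ∀ n, 0 ≤ T n := by
    intro n
    induction n with
    | zero => exact hP0
    | succ n ih => rw [hTs, ← hΦ0]; exact hΦmono ih
  have hTP : ∀ n, T n ≤ P := fun n => hTanti (Nat.zero_le n)
  obtain ⟨L, hL⟩ := sod_limit T hTanti hT0 (fun n => (hTP n).trans hP1)
  have hfix : Φ L = L := by
    ext x
    have h1 : Filter.Tendsto (fun n => T (n + 1) x) Filter.atTop (nhds (L x)) :=
      (Filter.tendsto_add_atTop_iff_nat 1).2 (hL x)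
    have h2 : Filter.Tendsto (fun n => T (n + 1) x) Filter.atTop (nhds (Φ L x)) := by
      simp only [hTs, Φ, ContinuousLinearMap.sum_apply]
      refine tendsto_finset_sum _ fun i _ => ?_
      exact ((A i).continuous.tendsto _).comp (hL (star (A i) x))
    exact tendsto_nhds_unique h2 h1
  obtain ⟨c, hc⟩ := hergodic L hfix
  have hTΩ : ∀ n, ⟪T n Ω, Ω⟫_ℂ = 1 := by
    intro n
    induction n with
    | zero =>
      have : T 0 Ω = Ω := Submodule.starProjection_eq_self_iff.2 hΩK
      rw [this, inner_self_eq_norm_sq_to_K, hΩ]; simp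
    | succ n ih =>
      rw [hTs]
      simp only [Φ, ContinuousLinearMap.sum_apply, sum_inner]
      have : ∀ i, ⟪(A i * T n * star (A i)) Ω, Ω⟫_ℂ = ((‖ω i‖ ^ 2 : ℝ) : ℂ) := by
        intro i
        have e : (A i * T n * star (A i)) Ω
            = A i (T n (ContinuousLinearMap.adjoint (A i) Ω)) := rfl
        rw [e, ← ContinuousLinearMap.adjoint_inner_right, heig, map_smul, inner_smul_left,
          inner_smul_right, ih]
        simp [Complex.mul_conj, Complex.normSq_eq_norm_sq]
      simp only [this]
      rw [← Complex.ofReal_sum, hω]; simp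
  have hc1 : c = 1 := by
    have h1 : Filter.Tendsto (fun n => ⟪Ω, T n Ω⟫_ℂ) Filter.atTop (nhds ⟪Ω, L Ω⟫_ℂ) :=
      tendsto_const_nhds.inner (hL Ω)
    have h2 : ∀ n, ⟪Ω, T n Ω⟫_ℂ = 1 := fun n => by
      rw [← inner_conj_symm, hTΩ]; simp
    simp only [h2] at h1
    have h3 := tendsto_nhds_unique h1 tendsto_const_nhds
    rw [hc] at h3
    simpa [inner_smul_right, inner_self_eq_norm_sq_to_K, hΩ] using h3
  rw [hc1, one_smul] at hc
  rw [Submodule.dense_iff_topologicalClosure_eq_top, Submodule.topologicalClosure_eq_top_iff,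
    Submodule.eq_bot_iff]
  intro x hx
  have hPx : P x = 0 := by
    rw [hP, Submodule.starProjection_apply_eq_zero_iff, hK, Submodule.orthogonal_closure]
    exact hx
  have hle : ∀ n, (⟪x, T n x⟫_ℂ).re ≤ 0 := fun n => by
    have := sod_re_le (hTP n) x
    rw [hPx, inner_zero_left] at this
    rw [← inner_conj_symm, Complex.conj_re]; simpa using this
  have hlim : Filter.Tendsto (fun n => (⟪x, T n x⟫_ℂ).re) Filter.atTop (nhds (⟪x, L x⟫_ℂ).re) :=
    (Complex.continuous_re.tendsto _).comp (tendsto_const_nhds.inner (hL x))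
  have h := le_of_tendsto' hlim hle
  rw [hc] at h
  have e : (⟪x, x⟫_ℂ).re = ‖x‖ ^ 2 := inner_self_eq_norm_sq (𝕜 := ℂ) x
  have h' : ‖x‖ ^ 2 ≤ 0 := by
    rw [← e]; exact h
  have : ‖x‖ = 0 := by nlinarith [norm_nonneg x]
  simpa using this
end

section
/- With ℓ_i := A_iΩ − ω_iΩ ∈ H° and Å_i ∈ B(H°) the restriction of A_i to the invariant subspace H° = {Ω}⊥, the linear span of {Å_α ℓ_i : α ∈ Λ̃, 1 ≤ i ≤ d} is dense in H°. -/
open scoped InnerProductSpace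

open Filter Topology ContinuousLinearMap in
/-- A decreasing sequence of operators between 0 and 1 converges strongly. -/
theorem aux_vigier {H : Type*} [NormedAddCommGroup H] [InnerProductSpace ℂ H] [CompleteSpace H]
    (T : ℕ → H →L[ℂ] H) (hT : Antitone T) (h0 : ∀ n, 0 ≤ T n) (h1 : ∀ n, T n ≤ 1) :
    ∃ Q : H →L[ℂ] H, ∀ x, Tendsto (fun n => T n x) atTop (𝓝 (Q x)) := by
  have key : ∀ D : H →L[ℂ] H, 0 ≤ D → D ≤ 1 → ∀ x, ‖D x‖ ^ 2 ≤ (⟪D x, x⟫_ℂ).re := by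
    intro D hD0 hD1 x
    have hsa : IsSelfAdjoint D := IsSelfAdjoint.of_nonneg hD0
    have hsa' : IsSelfAdjoint (1 - D) := (IsSelfAdjoint.one _).sub hsa
    have e : D - D * D = D * (1 - D) * D + (1 - D) * D * (1 - D) := by noncomm_ring
    have hp : 0 ≤ D - D * D := by
      rw [e]
      exact add_nonneg (hsa.conjugate_nonneg (sub_nonneg.2 hD1)) (hsa'.conjugate_nonneg hD0)
    have h2 := ((nonneg_iff_isPositive _).1 hp).re_inner_nonneg_left x
    have h3 : ⟪D (D x), x⟫_ℂ = ⟪D x, D x⟫_ℂ :=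
      ((nonneg_iff_isPositive _).1 hD0).inner_left_eq_inner_right _ _
    simp only [sub_apply, mul_apply_eq_comp, inner_sub_left, h3, map_sub] at h2
    rw [inner_self_eq_norm_sq (𝕜 := ℂ)] at h2
    simpa using h2
  have conv : ∀ x, ∃ y, Tendsto (fun n => T n x) atTop (𝓝 y) := by
    intro x
    apply cauchySeq_tendsto_of_complete
    have hanti : Antitone fun n => (⟪T n x, x⟫_ℂ).re := by
      intro n m hnm
      have := ((le_def _ _).1 (hT hnm)).re_inner_nonneg_left x
      simpa [inner_sub_left] using this
    have hb : BddBelow (Set.range fun n => (⟪T n x, x⟫_ℂ).re) := by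
      refine ⟨0, ?_⟩
      rintro _ ⟨n, rfl⟩
      exact ((nonneg_iff_isPositive _).1 (h0 n)).re_inner_nonneg_left x
    have hc := (tendsto_atTop_ciInf hanti hb).cauchySeq
    rw [Metric.cauchySeq_iff'] at hc ⊢
    intro ε hε
    obtain ⟨N, hN⟩ := hc (ε ^ 2) (by positivity)
    refine ⟨N, fun n hn => ?_⟩
    have h2 := hN n hn
    have h3 := key (T N - T n) (sub_nonneg.2 (hT hn))
      ((sub_le_self _ (h0 n)).trans (h1 N)) x
    rw [Real.dist_eq, abs_sub_comm] at h2
    have h4 := (le_abs_self _).trans_lt h2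
    rw [dist_comm, dist_eq_norm]
    simp only [sub_apply, inner_sub_left, Complex.sub_re] at h3
    exact lt_of_pow_lt_pow_left₀ 2 hε.le (h3.trans_lt h4)
  choose f hf using conv
  exact ⟨continuousLinearMapOfTendsto (σ₁₂ := RingHom.id ℂ) T (tendsto_pi_nhds.2 hf), hf⟩

open Filter Topology ContinuousLinearMap in
theorem aux_ergodic {H : Type*} [NormedAddCommGroup H] [InnerProductSpace ℂ H] [CompleteSpace H]
    (d : ℕ) (A : Fin d → H →L[ℂ] H)
    (hco : ∑ i, A i ∘L ContinuousLinearMap.adjoint (A i) = 1)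
    (hergodic : ∀ x : H →L[ℂ] H,
      (∑ i, A i ∘L x ∘L ContinuousLinearMap.adjoint (A i)) = x → ∃ c : ℂ, x = c • 1)
    (Ω : H) (hΩ : ‖Ω‖ = 1)
    (ω : Fin d → ℂ)
    (heig : ∀ i, ContinuousLinearMap.adjoint (A i) Ω = (starRingEnd ℂ) (ω i) • Ω)
    (N : Submodule ℂ H) [N.HasOrthogonalProjection] (hN : Ω ∈ N)
    (hinv : ∀ i, ∀ x ∈ N, A i x ∈ N) : Nᗮ = ⊥ := by
  set R := N.starProjection with hR
  have hRp : IsStarProjection R := isStarProjection_starProjection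
  set Φ : (H →L[ℂ] H) → (H →L[ℂ] H) := fun x => ∑ i, A i * x * star (A i) with hΦ
  have hΦ1 : Φ 1 = 1 := by
    refine Eq.trans ?_ hco
    simp only [hΦ, mul_one]; rfl
  have hmono : Monotone Φ := fun x y hxy =>
    Finset.sum_le_sum fun i _ => star_right_conjugate_le_conjugate hxy _
  have hR0 : 0 ≤ R := hRp.nonneg
  have hR1 : R ≤ 1 := hRp.le_one
  have hΦ0 : Φ 0 = 0 := by simp [hΦ]
  have hAR : ∀ i, R * (A i * R) = A i * R := by
    intro i
    ext x
    exact Submodule.starProjection_eq_self_iff.2 (hinv i _ (Submodule.starProjection_apply_mem _ _))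
  have hΦR : Φ R ≤ R := by
    have e : Φ R = R * Φ R * R := by
      simp only [hΦ, Finset.mul_sum, Finset.sum_mul]
      refine Finset.sum_congr rfl fun i _ => ?_
      have hs : star (A i * R) = R * star (A i) := by
        rw [star_mul, hRp.isSelfAdjoint.star_eq]
      have h2 : A i * R * star (A i) = (A i * R) * star (A i * R) := by
        rw [hs, mul_assoc, mul_assoc, ← mul_assoc R R, hRp.isIdempotentElem.eq]
      have h3 : star (A i * R) * R = star (A i * R) := by
        have := congrArg star (hAR i)
        rwa [star_mul, hRp.isSelfAdjoint.star_eq] at this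
      rw [h2, ← mul_assoc R, hAR, mul_assoc (A i * R) _ R, h3]
    have h := hRp.isSelfAdjoint.conjugate_le_conjugate (hmono hR1)
    rw [← e, hΦ1, mul_one, hRp.isIdempotentElem.eq] at h
    exact h
  have hanti : Antitone fun n => Φ^[n] R := by
    apply antitone_nat_of_succ_le
    intro n
    rw [Function.iterate_succ_apply]
    exact hmono.iterate n hΦR
  have h0 : ∀ n, 0 ≤ Φ^[n] R := by
    intro n
    have := hmono.iterate n hR0
    rwa [Function.iterate_fixed hΦ0] at this
  have hleR : ∀ n, Φ^[n] R ≤ R := fun n => hanti (Nat.zero_le n)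
  obtain ⟨Q, hQ⟩ := aux_vigier _ hanti h0 (fun n => (hleR n).trans hR1)
  have hfix : Φ Q = Q := by
    ext x
    have h2 : Tendsto (fun n => Φ^[n+1] R x) atTop (𝓝 (Q x)) :=
      (hQ x).comp (tendsto_add_atTop_nat 1)
    refine tendsto_nhds_unique ?_ h2
    simp only [Function.iterate_succ_apply']
    simp only [hΦ, sum_apply, mul_apply_eq_comp]
    exact tendsto_finsetSum _ fun i _ => ((A i).continuous.tendsto _).comp (hQ _)
  obtain ⟨c, hc⟩ := hergodic Q hfix
  have hTΩ : ∀ n, (Φ^[n] R) Ω = Ω := by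
    intro n
    induction n with
    | zero => exact Submodule.starProjection_eq_self_iff.2 hN
    | succ n ih =>
      rw [Function.iterate_succ_apply']
      have h2 := congrArg (fun T : H →L[ℂ] H => T Ω) hco
      simp only [sum_apply, comp_apply, one_apply_eq_self] at h2
      conv_rhs => rw [← h2]
      simp only [hΦ, sum_apply, mul_apply_eq_comp]
      refine Finset.sum_congr rfl fun i _ => ?_
      rw [star_eq_adjoint, heig, map_smul, ih]
  have hQΩ : Q Ω = Ω := tendsto_nhds_unique (hQ Ω) (by simp only [hTΩ]; exact tendsto_const_nhds)
  have hΩ0 : Ω ≠ 0 := by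
    intro h; simp [h] at hΩ
  have hc1 : c = 1 := by
    rw [hc] at hQΩ
    have h2 : (c - 1) • Ω = 0 := by
      rw [sub_smul, one_smul, sub_eq_zero]; simpa using hQΩ
    exact sub_eq_zero.1 ((smul_eq_zero.1 h2).resolve_right hΩ0)
  have hQ1 : ∀ x, Q x = x := by
    intro x; rw [hc, hc1]; simp
  rw [Submodule.eq_bot_iff]
  intro x hx
  have hRx : R x = 0 := (Submodule.starProjection_apply_eq_zero_iff N).2 hx
  have hlim : Tendsto (fun n => (⟪(Φ^[n] R) x, x⟫_ℂ).re) atTop (𝓝 (⟪Q x, x⟫_ℂ).re) :=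
    (Complex.continuous_re.tendsto _).comp ((hQ x).inner tendsto_const_nhds)
  have hle : (⟪Q x, x⟫_ℂ).re ≤ 0 := by
    refine le_of_tendsto' hlim fun n => ?_
    have := ((le_def _ _).1 (hleR n)).re_inner_nonneg_left x
    simpa [inner_sub_left, hRx] using this
  rw [hQ1] at hle
  have h5 : ‖x‖ ^ 2 ≤ 0 := by
    rw [← inner_self_eq_norm_sq (𝕜 := ℂ)]; exact hle
  exact norm_eq_zero.1 (pow_eq_zero_iff two_ne_zero |>.1 (le_antisymm h5 (by positivity)))

/-- With `ℓ i = A i Ω − ω i • Ω ∈ H° = {Ω}ᗮ` and `H°` invariant under the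
`A i`, the span of `{Å_α ℓ_i}` (equivalently, of `{A_α ℓ_i}`) is dense in `H°`. -/
theorem span_defect_orbit_dense
    {H : Type*} [NormedAddCommGroup H] [InnerProductSpace ℂ H] [CompleteSpace H]
    (d : ℕ) (hd : 2 ≤ d) (A : Fin d → H →L[ℂ] H)
    (hco : ∑ i, A i ∘L ContinuousLinearMap.adjoint (A i) = 1)
    (hergodic : ∀ x : H →L[ℂ] H,
      (∑ i, A i ∘L x ∘L ContinuousLinearMap.adjoint (A i)) = x → ∃ c : ℂ, x = c • 1)
    (Ω : H) (hΩ : ‖Ω‖ = 1)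
    (ω : Fin d → ℂ) (hω : ∑ i, ‖ω i‖ ^ 2 = 1)
    (heig : ∀ i, ContinuousLinearMap.adjoint (A i) Ω = (starRingEnd ℂ) (ω i) • Ω) :
    (Submodule.span ℂ
      {h : H | ∃ (n : ℕ) (α : Fin n → Fin d) (i : Fin d),
        h = (List.ofFn fun j => A (α j)).prod (A i Ω - ω i • Ω)}).topologicalClosure =
      (Submodule.span ℂ {Ω})ᗮ := by
  set S := {h : H | ∃ (n : ℕ) (α : Fin n → Fin d) (i : Fin d),
        h = (List.ofFn fun j => A (α j)).prod (A i Ω - ω i • Ω)} with hS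
  have hΩΩ : ⟪Ω, Ω⟫_ℂ = 1 := by
    rw [inner_self_eq_norm_sq_to_K, hΩ]; simp
  have horth : ∀ i x, ⟪Ω, x⟫_ℂ = 0 → ⟪Ω, A i x⟫_ℂ = 0 := by
    intro i x hx
    rw [← ContinuousLinearMap.adjoint_inner_left, heig, inner_smul_left, hx, mul_zero]
  have hl : ∀ i, ⟪Ω, A i Ω - ω i • Ω⟫_ℂ = 0 := by
    intro i
    rw [inner_sub_right, ← ContinuousLinearMap.adjoint_inner_left, heig, inner_smul_left,
      inner_smul_right, hΩΩ]
    simp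
  have hSorth : ∀ x ∈ S, ⟪Ω, x⟫_ℂ = 0 := by
    rintro x ⟨n, α, i, rfl⟩
    generalize hL : List.ofFn (fun j => A (α j)) = L
    have hmem : ∀ B ∈ L, ∃ j, B = A j := by
      intro B hB
      rw [← hL, List.mem_ofFn] at hB
      obtain ⟨j, rfl⟩ := hB
      exact ⟨_, rfl⟩
    clear hL
    induction L with
    | nil => simpa using hl i
    | cons B L ih =>
      obtain ⟨j, rfl⟩ := hmem B (by simp)
      rw [List.prod_cons]
      exact horth j _ (ih fun C hC => hmem C (by simp [hC]))
  have hSA : ∀ i, ∀ x ∈ S, A i x ∈ S := by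
    rintro k x ⟨n, α, i, rfl⟩
    refine ⟨n + 1, Fin.cons k α, i, ?_⟩
    simp [List.ofFn_succ]
  have hlS : ∀ i, A i Ω - ω i • Ω ∈ S := fun i => ⟨0, Fin.elim0, i, by simp⟩
  set V := Submodule.span ℂ {Ω} ⊔ Submodule.span ℂ S with hV
  have hΩV : Ω ∈ V := Submodule.mem_sup_left (Submodule.mem_span_singleton_self Ω)
  have hVinv : ∀ i, V ≤ V.comap (A i).toLinearMap := by
    intro i
    refine sup_le ?_ ?_
    · rw [Submodule.span_le, Set.singleton_subset_iff]
      have : A i Ω = (A i Ω - ω i • Ω) + ω i • Ω := by abel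
      change A i Ω ∈ V
      rw [this]
      exact V.add_mem (Submodule.mem_sup_right (Submodule.subset_span (hlS i))) (V.smul_mem _ hΩV)
    · rw [Submodule.span_le]
      intro x hx
      exact Submodule.mem_sup_right (Submodule.subset_span (hSA i x hx))
  have hVbot : Vᗮ = ⊥ := by
    rw [← Submodule.orthogonal_closure]
    refine aux_ergodic d A hco hergodic Ω hΩ ω heig V.topologicalClosure
      (V.le_topologicalClosure hΩV) ?_
    intro i x hx
    exact map_mem_closure (A i).continuous hx (fun y hy => hVinv i hy)
  have hle : (Submodule.span ℂ S).topologicalClosure ≤ (Submodule.span ℂ {Ω})ᗮ := by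
    refine Submodule.topologicalClosure_minimal _ ?_ (Submodule.isClosed_orthogonal _)
    rw [Submodule.span_le]
    intro x hx
    exact Submodule.mem_orthogonal_singleton_iff_inner_right.2 (hSorth x hx)
  have h := Submodule.sup_orthogonal_inf_of_hasOrthogonalProjection hle
  rw [Submodule.orthogonal_closure, Submodule.inf_orthogonal, sup_comm (Submodule.span ℂ S),
    ← hV, hVbot, sup_bot_eq] at h
  exact h
end

section
/- One has ∑_{i=1}^d conj(ω_i) ℓ_i = 0 (equivalently, the operator A_Ω* := ∑_{i=1}^d ω_i A_i* maps H° into H°), and on H° the identity 1_{H°} − ∑_{i=1}^d Å_iÅ_i* = ∑_{i=1}^d |ℓ_i⟩⟨ℓ_i| holds, i.e. for every h ∈ H°: h − ∑_{i=1}^d Å_i Å_i* h = ∑_{i=1}^d ⟨ℓ_i, h⟩ ℓ_i. -/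
open scoped InnerProductSpace

/-- `∑ i, conj (ω i) • ℓ i = 0`, and on `H°` one has
`1 − ∑ i Å_i Å_i* = ∑ i |ℓ i⟩⟨ℓ i|`, i.e. for every `h ∈ H°`:
`h − ∑ i Å_i Å_i* h = ∑ i ⟨ℓ i, h⟩ • ℓ i`. -/
theorem defect_rank_formula
    {H : Type*} [NormedAddCommGroup H] [InnerProductSpace ℂ H] [CompleteSpace H]
    (d : ℕ) (hd : 2 ≤ d) (A : Fin d → H →L[ℂ] H)
    (hco : ∑ i, A i ∘L ContinuousLinearMap.adjoint (A i) = 1)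
    (Ω : H) (hΩ : ‖Ω‖ = 1)
    (ω : Fin d → ℂ) (hω : ∑ i, ‖ω i‖ ^ 2 = 1)
    (heig : ∀ i, ContinuousLinearMap.adjoint (A i) Ω = (starRingEnd ℂ) (ω i) • Ω)
    (Ar : Fin d → ((Submodule.span ℂ {Ω})ᗮ : Submodule ℂ H) →L[ℂ]
      ((Submodule.span ℂ {Ω})ᗮ : Submodule ℂ H))
    (hAr : ∀ (i : Fin d) (h : ((Submodule.span ℂ {Ω})ᗮ : Submodule ℂ H)),
      (Ar i h : H) = A i (h : H))
    (ℓ : Fin d → ((Submodule.span ℂ {Ω})ᗮ : Submodule ℂ H))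
    (hℓ : ∀ i, (ℓ i : H) = A i Ω - ω i • Ω) :
    (∑ i, (starRingEnd ℂ) (ω i) • ℓ i = 0) ∧
      ∀ h : ((Submodule.span ℂ {Ω})ᗮ : Submodule ℂ H),
        h - ∑ i, Ar i (ContinuousLinearMap.adjoint (Ar i) h) = ∑ i, ⟪ℓ i, h⟫_ℂ • ℓ i := by
  have hΩΩ : ⟪Ω, Ω⟫_ℂ = 1 := by
    rw [inner_self_eq_norm_sq_to_K, hΩ]; simp
  have hco' : ∀ x : H, ∑ i, A i (ContinuousLinearMap.adjoint (A i) x) = x := by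
    intro x
    have := congrArg (fun T : H →L[ℂ] H => T x) hco
    simpa [ContinuousLinearMap.sum_apply] using this
  have hωc : ∑ i, (starRingEnd ℂ) (ω i) * ω i = 1 := by
    have : ((∑ i, ‖ω i‖ ^ 2 : ℝ) : ℂ) = 1 := by rw [hω]; simp
    rw [← this]
    push_cast
    exact Finset.sum_congr rfl fun i _ => Complex.conj_mul' (ω i)
  have hperp : ∀ h : ((Submodule.span ℂ {Ω})ᗮ : Submodule ℂ H), ⟪Ω, (h : H)⟫_ℂ = 0 :=
    fun h => Submodule.mem_orthogonal_singleton_iff_inner_right.1 h.2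
  have hperp' : ∀ h : ((Submodule.span ℂ {Ω})ᗮ : Submodule ℂ H), ⟪(h : H), Ω⟫_ℂ = 0 :=
    fun h => Submodule.mem_orthogonal_singleton_iff_inner_left.1 h.2
  have h1 : ∑ i, (starRingEnd ℂ) (ω i) • ℓ i = 0 := by
    apply Subtype.ext
    have h2 := hco' Ω
    simp only [heig, map_smul] at h2
    simp only [Submodule.coe_sum, Submodule.coe_smul, hℓ, smul_sub, Finset.sum_sub_distrib, h2,
      smul_smul, ← Finset.sum_smul, hωc, one_smul, sub_self, Submodule.coe_zero]
  refine ⟨h1, fun h => ?_⟩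
  have hin : ∀ i, ⟪ℓ i, h⟫_ℂ = ⟪A i Ω, (h : H)⟫_ℂ := by
    intro i
    rw [Submodule.coe_inner, hℓ, inner_sub_left, inner_smul_left, hperp]; simp
  have hdec : ∀ i, ContinuousLinearMap.adjoint (A i) (h : H)
      = (ContinuousLinearMap.adjoint (Ar i) h : H) + ⟪ℓ i, h⟫_ℂ • Ω := by
    intro i
    rw [← sub_eq_zero]
    set x : H := ContinuousLinearMap.adjoint (A i) (h : H)
      - ((ContinuousLinearMap.adjoint (Ar i) h : H) + ⟪ℓ i, h⟫_ℂ • Ω) with hx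
    have hxm : x ∈ (Submodule.span ℂ {Ω})ᗮ := by
      rw [Submodule.mem_orthogonal_singleton_iff_inner_right, hx, inner_sub_right,
        inner_add_right, inner_smul_right, hperp, hΩΩ, hin,
        ContinuousLinearMap.adjoint_inner_right]
      simp
    have key : ∀ g : ((Submodule.span ℂ {Ω})ᗮ : Submodule ℂ H), ⟪(g : H), x⟫_ℂ = 0 := by
      intro g
      rw [hx, inner_sub_right, inner_add_right, inner_smul_right, hperp',
        ContinuousLinearMap.adjoint_inner_right, ← Submodule.coe_inner,
        ContinuousLinearMap.adjoint_inner_right, Submodule.coe_inner, hAr]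
      simp
    exact inner_self_eq_zero.1 (key ⟨x, hxm⟩)
  have hz : ∑ i, ⟪ℓ i, h⟫_ℂ * ω i = 0 := by
    have := congrArg (fun y => ⟪y, h⟫_ℂ) h1
    simp only [sum_inner, inner_smul_left, inner_zero_left, Complex.conj_conj] at this
    rw [← this]
    exact Finset.sum_congr rfl fun i _ => mul_comm _ _
  have h3 := hco' (h : H)
  simp only [hdec, map_add, map_smul, Finset.sum_add_distrib] at h3
  apply Subtype.ext
  simp only [Submodule.coe_sub, Submodule.coe_sum, Submodule.coe_smul, hAr, hℓ, smul_sub,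
    Finset.sum_sub_distrib, smul_smul, ← Finset.sum_smul, hz, zero_smul, sub_zero]
  rw [sub_eq_iff_eq_add, add_comm]
  exact h3.symm
end

section
/- For every h ∈ H°, the series ∑_{n=0}^∞ ∑_{α ∈ {1,…,d}ⁿ} ∑_{i=1}^d |⟨ℓ_i, Å_α* h⟩|² converges and equals ‖h‖². (This expresses that the map Ĉ from Proposition 4.2, sending h ∈ H° to ∑_{α∈Λ̃} e_α ⊗ D̂_* Å_α* h where D̂_* h = ∑_i ⟨ℓ_i, h⟩ε_i, is a well-defined isometry.) -/
open scoped InnerProductSpace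

open Filter Topology ContinuousLinearMap in
lemma pk_decr_lim {K : Type*} [NormedAddCommGroup K] [InnerProductSpace ℂ K] [CompleteSpace K]
    (Q : ℕ → K →L[ℂ] K) (hanti : Antitone Q) (h0 : ∀ n, 0 ≤ Q n) (h1 : ∀ n, Q n ≤ 1) :
    ∃ L : K →L[ℂ] K, ∀ x, Tendsto (fun n => Q n x) atTop (𝓝 (L x)) := by
  have key : ∀ m n, m ≤ n → ∀ x, ‖Q m x - Q n x‖ ^ 2 ≤
      RCLike.re ⟪Q m x, x⟫_ℂ - RCLike.re ⟪Q n x, x⟫_ℂ := by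
    intro m n hmn x
    set D := Q m - Q n with hD
    have hD0 : 0 ≤ D := sub_nonneg.2 (hanti hmn)
    have hD1 : D ≤ 1 := (sub_le_self _ (h0 n)).trans (h1 m)
    have h2 : D ^ 2 ≤ D ^ 1 := CStarAlgebra.pow_antitone hD0 hD1 (by norm_num)
    have h3 := ((ContinuousLinearMap.le_def _ _).1 h2).re_inner_nonneg_left x
    have hDp := (ContinuousLinearMap.nonneg_iff_isPositive _).1 hD0
    have h4 : ⟪(D ^ 2) x, x⟫_ℂ = ⟪D x, D x⟫_ℂ := by
      rw [pow_two, mul_apply_eq_comp, hDp.inner_left_eq_inner_right]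
    rw [_root_.sub_apply, inner_sub_left, h4, pow_one, map_sub,
      inner_self_eq_norm_sq] at h3
    have h5 : D x = Q m x - Q n x := by simp [hD]
    rw [h5, inner_sub_left, map_sub] at h3
    linarith
  have hq : ∀ x, ∃ l, Tendsto (fun n => RCLike.re ⟪Q n x, x⟫_ℂ) atTop (𝓝 l) := by
    intro x
    refine ⟨_, tendsto_atTop_ciInf ?_ ⟨0, ?_⟩⟩
    · intro m n hmn
      have := key m n hmn x
      have := sq_nonneg ‖Q m x - Q n x‖
      show RCLike.re ⟪Q n x, x⟫_ℂ ≤ RCLike.re ⟪Q m x, x⟫_ℂ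
      linarith
    · rintro _ ⟨n, rfl⟩
      exact ((ContinuousLinearMap.nonneg_iff_isPositive _).1 (h0 n)).re_inner_nonneg_left x
  have hc : ∀ x, ∃ y, Tendsto (fun n => Q n x) atTop (𝓝 y) := by
    intro x
    obtain ⟨l, hl⟩ := hq x
    apply cauchySeq_tendsto_of_complete
    have hC := Metric.cauchySeq_iff'.1 hl.cauchySeq
    rw [Metric.cauchySeq_iff']
    intro ε hε
    obtain ⟨N, hN⟩ := hC (ε ^ 2) (by positivity)
    refine ⟨N, fun n hn => ?_⟩
    have h1 := hN n hn
    rw [Real.dist_eq, abs_lt] at h1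
    have h2 := key N n hn x
    rw [dist_eq_norm, norm_sub_rev]
    exact lt_of_pow_lt_pow_left₀ 2 hε.le (by linarith)
  choose f hf using hc
  exact ⟨continuousLinearMapOfTendsto Q (tendsto_pi_nhds.2 hf), hf⟩

open Filter Topology ContinuousLinearMap in
lemma pk_iter {K : Type*} [NormedAddCommGroup K] [InnerProductSpace ℂ K] [CompleteSpace K]
    (d : ℕ) (B : Fin d → K →L[ℂ] K) (ℓ : Fin d → K)
    (hB : ∀ h, ‖h‖ ^ 2 = ∑ i, ‖adjoint (B i) h‖ ^ 2 + ∑ i, ‖⟪ℓ i, h⟫_ℂ‖ ^ 2)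
    (hfix : ∀ L : K →L[ℂ] K, ∑ i, B i ∘L L ∘L adjoint (B i) = L → L = 0) (h : K) :
    HasSum (fun n : ℕ => ∑ α : Fin n → Fin d, ∑ i : Fin d,
          ‖⟪ℓ i, adjoint ((List.ofFn fun k => B (α k)).prod) h⟫_ℂ‖ ^ 2) (‖h‖ ^ 2) := by
  set T : (K →L[ℂ] K) → (K →L[ℂ] K) := fun x => ∑ i, B i ∘L x ∘L adjoint (B i) with hT
  have hTin : ∀ x u, RCLike.re ⟪T x u, u⟫_ℂ =
      ∑ i, RCLike.re ⟪x (adjoint (B i) u), adjoint (B i) u⟫_ℂ := by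
    intro x u
    simp only [hT, _root_.sum_apply, sum_inner, map_sum, comp_apply,
      adjoint_inner_right]
  have hTsub : ∀ x y, T x - T y = T (x - y) := by
    intro x y
    ext u
    simp [hT, _root_.sum_apply, Finset.sum_sub_distrib]
  have hTpos : ∀ x, 0 ≤ x → 0 ≤ T x := by
    intro x hx
    rw [nonneg_iff_isPositive] at hx ⊢
    exact isPositive_sum _ fun i _ => hx.conj_adjoint (B i)
  have hTmono : Monotone T := by
    intro x y hxy
    rw [← sub_nonneg, hTsub]
    exact hTpos _ (sub_nonneg.2 hxy)
  have one0 : (0 : K →L[ℂ] K) ≤ 1 := (nonneg_iff_isPositive _).2 isPositive_one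
  have hT1 : T 1 ≤ 1 := by
    rw [ContinuousLinearMap.le_def, isPositive_def']
    refine ⟨(IsSelfAdjoint.one _).sub ((nonneg_iff_isPositive _).1 (hTpos 1 one0)).isSelfAdjoint, ?_⟩
    intro u
    rw [reApplyInnerSelf_apply, _root_.sub_apply, inner_sub_left, map_sub, hTin]
    simp only [one_apply_eq_self, inner_self_eq_norm_sq]
    rw [hB u]
    have : 0 ≤ ∑ i, ‖⟪ℓ i, u⟫_ℂ‖ ^ 2 := by positivity
    linarith
  set Q : ℕ → K →L[ℂ] K := fun n => T^[n] 1 with hQ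
  have hQs : ∀ n, Q (n + 1) = T (Q n) := fun n => Function.iterate_succ_apply' T n 1
  have hanti : Antitone Q := by
    apply antitone_nat_of_succ_le
    intro n
    induction n with
    | zero => exact hT1
    | succ n ih => rw [hQs (n + 1), hQs n]; rw [hQs n] at ih; exact hTmono ih
  have hQ0 : ∀ n, 0 ≤ Q n := by
    intro n
    induction n with
    | zero => exact one0
    | succ n ih => rw [hQs]; exact hTpos _ ih
  obtain ⟨L, hL⟩ := pk_decr_lim Q hanti hQ0 (fun n => hanti (Nat.zero_le n))
  have hL0 : L = 0 := by
    apply hfix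
    ext u
    refine tendsto_nhds_unique ?_ ((tendsto_add_atTop_iff_nat 1).2 (hL u))
    simp only [hQs, hT, _root_.sum_apply, comp_apply]
    exact tendsto_finsetSum _ fun i _ => ((B i).continuous.tendsto _).comp (hL _)
  have hs : ∀ n, ∀ u : K, ∑ α : Fin n → Fin d, ∑ i : Fin d,
      ‖⟪ℓ i, adjoint ((List.ofFn fun k => B (α k)).prod) u⟫_ℂ‖ ^ 2 =
      RCLike.re ⟪Q n u, u⟫_ℂ - RCLike.re ⟪Q (n + 1) u, u⟫_ℂ := by
    intro n
    induction n with
    | zero =>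
      intro u
      rw [hQs, hTin]
      have : Q 0 = 1 := rfl
      simp only [this, one_apply_eq_self, inner_self_eq_norm_sq]
      rw [hB u]
      simp [← star_eq_adjoint]
    | succ n ih =>
      intro u
      have e1 := hTin (Q n) u
      have e2 := hTin (Q (n + 1)) u
      rw [← hQs] at e1 e2
      rw [e1, e2, ← Finset.sum_sub_distrib, Finset.sum_congr rfl (fun j _ => (ih _).symm)]
      rw [← (Fin.consEquiv (fun _ => Fin d)).sum_comp, Fintype.sum_prod_type]
      refine Finset.sum_congr rfl fun j _ => Finset.sum_congr rfl fun α _ =>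
        Finset.sum_congr rfl fun i _ => ?_
      rw [List.ofFn_succ, List.prod_cons, ← star_eq_adjoint, star_mul, star_eq_adjoint,
        star_eq_adjoint, mul_apply_eq_comp]
      simp [Fin.consEquiv]
  simp only [hs]
  have hnn : ∀ n, 0 ≤ RCLike.re ⟪Q n h, h⟫_ℂ - RCLike.re ⟪Q (n + 1) h, h⟫_ℂ := by
    intro n
    rw [← hs]
    positivity
  rw [hasSum_iff_tendsto_nat_of_nonneg hnn]
  simp only [Finset.sum_range_sub']
  have e0 : RCLike.re ⟪Q 0 h, h⟫_ℂ = ‖h‖ ^ 2 := inner_self_eq_norm_sq h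
  rw [e0]
  have hlim : Tendsto (fun n => RCLike.re ⟪Q n h, h⟫_ℂ) atTop (𝓝 (RCLike.re ⟪L h, h⟫_ℂ)) :=
    (RCLike.continuous_re.tendsto _).comp ((hL h).inner tendsto_const_nhds)
  rw [hL0] at hlim
  simpa using hlim.const_sub (‖h‖ ^ 2)


/-- For every `h ∈ H°`, the series
`∑_{n} ∑_{α ∈ {1,…,d}ⁿ} ∑_{i} |⟨ℓ i, Å_α* h⟩|²` converges to `‖h‖²`
(Popescu's Poisson kernel `Ĉ` is a well-defined isometry on `H°`). -/
theorem poisson_kernel_isometry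
    {H : Type*} [NormedAddCommGroup H] [InnerProductSpace ℂ H] [CompleteSpace H]
    (d : ℕ) (hd : 2 ≤ d) (A : Fin d → H →L[ℂ] H)
    (hco : ∑ i, A i ∘L ContinuousLinearMap.adjoint (A i) = 1)
    (hergodic : ∀ x : H →L[ℂ] H,
      (∑ i, A i ∘L x ∘L ContinuousLinearMap.adjoint (A i)) = x → ∃ c : ℂ, x = c • 1)
    (Ω : H) (hΩ : ‖Ω‖ = 1)
    (ω : Fin d → ℂ) (hω : ∑ i, ‖ω i‖ ^ 2 = 1)
    (heig : ∀ i, ContinuousLinearMap.adjoint (A i) Ω = (starRingEnd ℂ) (ω i) • Ω)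
    (Ar : Fin d → ((Submodule.span ℂ {Ω})ᗮ : Submodule ℂ H) →L[ℂ]
      ((Submodule.span ℂ {Ω})ᗮ : Submodule ℂ H))
    (hAr : ∀ (i : Fin d) (h : ((Submodule.span ℂ {Ω})ᗮ : Submodule ℂ H)),
      (Ar i h : H) = A i (h : H))
    (ℓ : Fin d → ((Submodule.span ℂ {Ω})ᗮ : Submodule ℂ H))
    (hℓ : ∀ i, (ℓ i : H) = A i Ω - ω i • Ω) :
    ∀ h : ((Submodule.span ℂ {Ω})ᗮ : Submodule ℂ H),
      HasSum
        (fun n : ℕ => ∑ α : Fin n → Fin d, ∑ i : Fin d,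
          ‖⟪ℓ i, ContinuousLinearMap.adjoint
            ((List.ofFn fun k => Ar (α k)).prod) h⟫_ℂ‖ ^ 2)
        (‖h‖ ^ 2) := by
  intro h
  have hΩ1 : ⟪Ω, Ω⟫_ℂ = 1 := by simp [inner_self_eq_norm_sq_to_K, hΩ]
  have horth : ∀ k : ((Submodule.span ℂ {Ω})ᗮ : Submodule ℂ H), ⟪Ω, (k : H)⟫_ℂ = 0 := fun k =>
    Submodule.mem_orthogonal_singleton_iff_inner_right.1 k.2
  have hl : ∀ i (k : ((Submodule.span ℂ {Ω})ᗮ : Submodule ℂ H)),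
      ⟪ℓ i, k⟫_ℂ = ⟪A i Ω, (k : H)⟫_ℂ := by
    intro i k
    rw [Submodule.coe_inner, hℓ, inner_sub_left, inner_smul_left, horth]
    simp
  have hdec : ∀ i (k : ((Submodule.span ℂ {Ω})ᗮ : Submodule ℂ H)),
      ContinuousLinearMap.adjoint (A i) (k : H) =
        (ContinuousLinearMap.adjoint (Ar i) k : H) + ⟪ℓ i, k⟫_ℂ • Ω := by
    intro i k
    have hmem : ContinuousLinearMap.adjoint (A i) (k : H) - ⟪ℓ i, k⟫_ℂ • Ω ∈
        (Submodule.span ℂ {Ω})ᗮ := by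
      rw [Submodule.mem_orthogonal_singleton_iff_inner_right, inner_sub_right, inner_smul_right,
        hΩ1, ContinuousLinearMap.adjoint_inner_right, hl]
      simp
    have : (⟨_, hmem⟩ : ((Submodule.span ℂ {Ω})ᗮ : Submodule ℂ H)) =
        ContinuousLinearMap.adjoint (Ar i) k := by
      refine ext_inner_left ℂ fun v => ?_
      rw [ContinuousLinearMap.adjoint_inner_right, Submodule.coe_inner,
        Submodule.coe_inner _ (Ar i v) k, hAr,
        inner_sub_right, inner_smul_right, ContinuousLinearMap.adjoint_inner_right,
        ← inner_conj_symm (v : H) Ω, horth]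
      simp
    rw [← this]
    simp
  refine pk_iter d Ar ℓ ?_ ?_ h
  · intro k
    have h1 : ‖(k : H)‖ ^ 2 = ∑ i, ‖ContinuousLinearMap.adjoint (A i) (k : H)‖ ^ 2 := by
      have := congrArg (fun x : H →L[ℂ] H => RCLike.re ⟪x (k : H), (k : H)⟫_ℂ) hco
      simp only [_root_.sum_apply, sum_inner, map_sum,
        ContinuousLinearMap.comp_apply, one_apply_eq_self, inner_self_eq_norm_sq] at this
      rw [← this]
      refine Finset.sum_congr rfl fun i _ => ?_
      rw [← ContinuousLinearMap.adjoint_inner_right, inner_self_eq_norm_sq]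
    rw [← Finset.sum_add_distrib, Submodule.coe_norm k, h1]
    refine Finset.sum_congr rfl fun i _ => ?_
    have ho : ⟪(ContinuousLinearMap.adjoint (Ar i) k : H), ⟪ℓ i, k⟫_ℂ • Ω⟫_ℂ = 0 := by
      rw [inner_smul_right, ← inner_conj_symm _ Ω, horth]; simp
    have := norm_add_sq_eq_norm_sq_add_norm_sq_of_inner_eq_zero _ _ ho
    rw [hdec, sq, this, norm_smul, hΩ]
    simp [sq]
  · intro L hLf
    set ι := ((Submodule.span ℂ {Ω})ᗮ : Submodule ℂ H).subtypeL with hι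
    have hiA : ∀ i, A i ∘L ι = ι ∘L Ar i := by
      intro i; ext k; simp [hι, hAr]
    have hiA' : ∀ i, ContinuousLinearMap.adjoint ι ∘L ContinuousLinearMap.adjoint (A i) =
        ContinuousLinearMap.adjoint (Ar i) ∘L ContinuousLinearMap.adjoint ι := by
      intro i
      rw [← ContinuousLinearMap.adjoint_comp, ← ContinuousLinearMap.adjoint_comp, hiA]
    obtain ⟨c, hc⟩ := hergodic (ι ∘L L ∘L ContinuousLinearMap.adjoint ι) (by
      conv_rhs => rw [← hLf]
      ext u
      simp only [_root_.sum_apply, ContinuousLinearMap.comp_apply, map_sum]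
      refine Finset.sum_congr rfl fun i _ => ?_
      have e1 := fun v => congrArg (fun f => f v) (hiA i)
      have e2 := congrArg (fun f => f u) (hiA' i)
      simp only [ContinuousLinearMap.comp_apply] at e1 e2
      rw [e2, e1])
    have hιΩ : ContinuousLinearMap.adjoint ι Ω = 0 := by
      refine ext_inner_left ℂ fun v => ?_
      rw [ContinuousLinearMap.adjoint_inner_right, inner_zero_right, ← inner_conj_symm]
      simp [hι, horth]
    have hc0 : c = 0 := by
      have := congrArg (fun f : H →L[ℂ] H => ⟪Ω, f Ω⟫_ℂ) hc
      simpa [hιΩ, inner_smul_right, hΩ] using this.symm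
    rw [hc0, zero_smul] at hc
    apply ContinuousLinearMap.ext
    intro k
    have e : ContinuousLinearMap.adjoint ι (k : H) = k := by
      refine ext_inner_left ℂ fun v => ?_
      rw [ContinuousLinearMap.adjoint_inner_right]; rfl
    have := congrArg (fun f : H →L[ℂ] H => f (k : H)) hc
    simp only [ContinuousLinearMap.comp_apply, e] at this
    exact Subtype.ext this
end

section
/- Let A₁,…,A_d ∈ B(H) with ∑_{i=1}^d A_i A_i* = 1 and let Ω ∈ H be a unit vector. Then ⟨Ω, Z(x)Ω⟩ = ⟨Ω, xΩ⟩ for all x ∈ B(H) (the vector state ⟨Ω, ·Ω⟩ is invariant for Z) if and only if there exist complex numbers ω₁,…,ω_d with ∑_{i=1}^d |ω_i|² = 1 such that A_i* Ω = conj(ω_i) Ω for all i = 1,…,d. -/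
open scoped InnerProductSpace

/-- For a coisometric tuple `A` and a unit vector `Ω`, the vector state
`⟨Ω, ·Ω⟩` is invariant for `Z(x) = ∑ i, A i ∘ x ∘ (A i)*` iff there exist `ω i ∈ ℂ` with
`∑ |ω i|² = 1` such that `(A i)* Ω = conj (ω i) • Ω` for all `i`. -/
theorem invariant_state_iff_eigenvector
    {H : Type*} [NormedAddCommGroup H] [InnerProductSpace ℂ H] [CompleteSpace H]
    (d : ℕ) (hd : 2 ≤ d) (A : Fin d → H →L[ℂ] H)
    (hco : ∑ i, A i ∘L ContinuousLinearMap.adjoint (A i) = 1)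
    (Ω : H) (hΩ : ‖Ω‖ = 1) :
    (∀ x : H →L[ℂ] H,
        ⟪Ω, (∑ i, A i ∘L x ∘L ContinuousLinearMap.adjoint (A i)) Ω⟫_ℂ = ⟪Ω, x Ω⟫_ℂ) ↔
      ∃ ω : Fin d → ℂ, (∑ i, ‖ω i‖ ^ 2 = 1) ∧
        ∀ i, ContinuousLinearMap.adjoint (A i) Ω = (starRingEnd ℂ) (ω i) • Ω := by
  have key : ∀ x : H →L[ℂ] H,
      ⟪Ω, (∑ i, A i ∘L x ∘L ContinuousLinearMap.adjoint (A i)) Ω⟫_ℂ =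
        ∑ i, ⟪ContinuousLinearMap.adjoint (A i) Ω,
          x (ContinuousLinearMap.adjoint (A i) Ω)⟫_ℂ := by
    intro x
    rw [ContinuousLinearMap.sum_apply, inner_sum]
    refine Finset.sum_congr rfl fun i _ => ?_
    rw [ContinuousLinearMap.adjoint_inner_left]
    rfl
  have hΩΩ : ⟪Ω, Ω⟫_ℂ = 1 := by
    rw [inner_self_eq_norm_sq_to_K, hΩ]; simp
  constructor
  · intro h
    let x : H →L[ℂ] H := ContinuousLinearMap.id ℂ H - (innerSL ℂ Ω).smulRight Ω
    have hx : ∀ y, x y = y - ⟪Ω, y⟫_ℂ • Ω := fun y => by simp [x]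
    have hort : ∀ y, ⟪Ω, x y⟫_ℂ = 0 := fun y => by
      rw [hx, inner_sub_right, inner_smul_right, hΩΩ]; simp
    have hself : ∀ y, ⟪y, x y⟫_ℂ = ((‖x y‖ ^ 2 : ℝ) : ℂ) := fun y => by
      have h1 : y = x y + ⟪Ω, y⟫_ℂ • Ω := by rw [hx]; simp
      have h2 : ⟪y, x y⟫_ℂ = ⟪x y, x y⟫_ℂ := by
        conv_lhs => enter [2]; rw [h1]
        rw [inner_add_left, inner_smul_left, hort]; simp
      rw [h2, inner_self_eq_norm_sq_to_K]; simp
    have h0 := h x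
    rw [key, hort] at h0
    simp only [hself] at h0
    rw [← Complex.ofReal_sum, Complex.ofReal_eq_zero,
      Finset.sum_eq_zero_iff_of_nonneg (fun i _ => by positivity)] at h0
    have hv : ∀ i, ContinuousLinearMap.adjoint (A i) Ω =
        ⟪Ω, ContinuousLinearMap.adjoint (A i) Ω⟫_ℂ • Ω := by
      intro i
      have h3 := h0 i (Finset.mem_univ i)
      have h4 : x (ContinuousLinearMap.adjoint (A i) Ω) = 0 := by simpa using h3
      rw [hx] at h4
      exact sub_eq_zero.mp h4
    refine ⟨fun i => (starRingEnd ℂ) ⟪Ω, ContinuousLinearMap.adjoint (A i) Ω⟫_ℂ, ?_, ?_⟩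
    · have h1 := h (ContinuousLinearMap.id ℂ H)
      rw [key] at h1
      simp only [ContinuousLinearMap.id_apply, hΩΩ, inner_self_eq_norm_sq_to_K] at h1
      have h2 : ∀ i, ‖(starRingEnd ℂ) ⟪Ω, ContinuousLinearMap.adjoint (A i) Ω⟫_ℂ‖ =
          ‖ContinuousLinearMap.adjoint (A i) Ω‖ := by
        intro i
        conv_rhs => rw [hv i]
        rw [norm_smul, hΩ, mul_one, RCLike.norm_conj]
      simp only [h2]
      apply Complex.ofReal_injective
      push_cast
      exact h1
    · intro i
      simpa using hv i
  · rintro ⟨ω, hω, hA⟩ x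
    rw [key]
    simp only [hA, map_smul, inner_smul_left, inner_smul_right, Complex.conj_conj]
    simp only [← mul_assoc, Complex.mul_conj, Complex.conj_mul']
    rw [← Finset.sum_mul]
    have : ∑ i, ((Complex.normSq (ω i) : ℝ) : ℂ) = 1 := by
      simp only [Complex.normSq_eq_norm_sq]
      exact_mod_cast hω
    first
      | rw [this, one_mul]
      | (have h' : ∑ i, ((‖ω i‖ : ℂ)) ^ 2 = 1 := by exact_mod_cast hω
         rw [h', one_mul])
end

section
/- If A is coisometric, i.e. ∑_{i=1}^d A_i A_i* = 1 on H, then its minimal isometric dilation satisfies the Cuntz relations: ∑_{i=1}^d V_i V_i* = 1 on K. -/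
/-- If `A` is coisometric, then its minimal isometric dilation `V`
satisfies the Cuntz relation `∑ i, V i (V i)* = 1`. -/
theorem dilation_cuntz_relation
    {H : Type*} [NormedAddCommGroup H] [InnerProductSpace ℂ H] [CompleteSpace H]
    {K : Type*} [NormedAddCommGroup K] [InnerProductSpace ℂ K] [CompleteSpace K]
    (d : ℕ) (hd : 2 ≤ d) (A : Fin d → H →L[ℂ] H)
    (hco : ∑ i, A i ∘L ContinuousLinearMap.adjoint (A i) = 1)
    (ι : H →ₗᵢ[ℂ] K) (V : Fin d → K →L[ℂ] K)
    (hVorth : ∀ i j, ContinuousLinearMap.adjoint (V i) ∘L V j =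
      if i = j then (1 : K →L[ℂ] K) else 0)
    (hdil : ∀ (i : Fin d) (h : H),
      ContinuousLinearMap.adjoint (V i) (ι h) = ι (ContinuousLinearMap.adjoint (A i) h))
    (hmin : Dense ((Submodule.span ℂ
      {k : K | ∃ (n : ℕ) (α : Fin n → Fin d) (h : H),
        k = (List.ofFn fun j => V (α j)).prod (ι h)} : Submodule ℂ K) : Set K)) :
    ∑ i, V i ∘L ContinuousLinearMap.adjoint (V i) = 1 := by
  have hV : ∀ i j x, ContinuousLinearMap.adjoint (V i) (V j x) = if i = j then x else 0 := by
    intro i j x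
    have := congrArg (fun T : K →L[ℂ] K => T x) (hVorth i j)
    simp only [ContinuousLinearMap.comp_apply] at this
    rw [this]
    split_ifs <;> simp
  have hgen : ∀ h, ∑ i, V i (ContinuousLinearMap.adjoint (V i) (ι h)) = ι h := by
    intro h
    set p := ∑ i, V i (ContinuousLinearMap.adjoint (V i) (ι h)) with hp
    have h1 : ∀ j, ContinuousLinearMap.adjoint (V j) (ι h - p) = 0 := by
      intro j
      rw [map_sub, hp, map_sum]
      simp [hV]
    have h2 : inner ℂ (ι h - p) p = 0 := by
      rw [hp, inner_sum]
      apply Finset.sum_eq_zero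
      intro i _
      rw [← ContinuousLinearMap.adjoint_inner_left, ← hp, h1, inner_zero_left]
    have h3 : inner ℂ p (ι h) = inner ℂ (ι h) (ι h) := by
      rw [hp, sum_inner, ι.inner_map_map]
      have e := congrArg (fun T : H →L[ℂ] H => T h) hco
      simp only [ContinuousLinearMap.sum_apply, ContinuousLinearMap.comp_apply,
        ContinuousLinearMap.one_apply] at e
      conv_rhs => rw [← e]
      rw [e, ← e, sum_inner, e]
      apply Finset.sum_congr rfl
      intro i _
      rw [← ContinuousLinearMap.adjoint_inner_right (V i),
        ← ContinuousLinearMap.adjoint_inner_right (A i), hdil, ι.inner_map_map]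
    have h4 : inner ℂ (ι h - p) (ι h - p) = 0 := by
      rw [inner_sub_right, h2, inner_sub_left, h3]; simp
    exact (sub_eq_zero.mp (inner_self_eq_zero.mp h4)).symm
  refine ContinuousLinearMap.ext_on hmin ?_
  rintro k ⟨n, α, h, rfl⟩
  simp only [ContinuousLinearMap.sum_apply, ContinuousLinearMap.comp_apply,
    ContinuousLinearMap.one_apply]
  cases n with
  | zero => simpa using hgen h
  | succ n =>
    rw [List.ofFn_succ, List.prod_cons]
    generalize (List.ofFn fun j : Fin n => V (α j.succ)).prod = T
    change ∑ i, V i (ContinuousLinearMap.adjoint (V i) (V (α 0) (T (ι h)))) = V (α 0) (T (ι h))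
    simp only [hV]
    rw [Finset.sum_eq_single (α 0)]
    · simp
    · intro b _ hb
      simp [hb]
    · simp
end

section
/- Let A₁ := (1/√2)·[[0,0,0],[1,0,0],[0,1,1]] and A₂ := (1/√2)·[[1,1,0],[0,0,1],[0,0,0]] in M₃(ℂ), and Ω := (1/√3)·(1,1,1)ᵀ ∈ ℂ³. Then A₁A₁* + A₂A₂* = 1, A_i*Ω = (1/√2)Ω for i = 1,2, and the map Z : M₃(ℂ) → M₃(ℂ), Z(x) = A₁xA₁* + A₂xA₂*, is ergodic: every x ∈ M₃(ℂ) with Z(x) = x is a scalar multiple of the identity matrix. -/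
open Matrix

/-- The explicit pair `A₁, A₂ ∈ M₃(ℂ)` is a coisometric row contraction,
`Ω = (1/√3)(1,1,1)ᵀ` is a common eigenvector of the adjoints with eigenvalue `1/√2`,
and the completely positive map `Z(x) = A₁ x A₁* + A₂ x A₂*` is ergodic. -/
theorem example_ergodic_cp_map
    (A₁ A₂ : Matrix (Fin 3) (Fin 3) ℂ)
    (hA₁ : A₁ = ((Real.sqrt 2 : ℂ))⁻¹ • !![0, 0, 0; 1, 0, 0; 0, 1, 1])
    (hA₂ : A₂ = ((Real.sqrt 2 : ℂ))⁻¹ • !![1, 1, 0; 0, 0, 1; 0, 0, 0])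
    (Ω : Fin 3 → ℂ) (hΩ : Ω = fun _ => ((Real.sqrt 3 : ℂ))⁻¹) :
    A₁ * A₁ᴴ + A₂ * A₂ᴴ = 1 ∧
      (A₁ᴴ *ᵥ Ω = ((Real.sqrt 2 : ℂ))⁻¹ • Ω ∧ A₂ᴴ *ᵥ Ω = ((Real.sqrt 2 : ℂ))⁻¹ • Ω) ∧
      (∀ x : Matrix (Fin 3) (Fin 3) ℂ,
        A₁ * x * A₁ᴴ + A₂ * x * A₂ᴴ = x → ∃ c : ℂ, x = c • 1) := by
  have hs : ((Real.sqrt 2 : ℂ))⁻¹ * ((Real.sqrt 2 : ℂ))⁻¹ = 1 / 2 := by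
    rw [← mul_inv, ← Complex.ofReal_mul, Real.mul_self_sqrt (by norm_num)]
    norm_num
  have hc : star ((Real.sqrt 2 : ℂ))⁻¹ = ((Real.sqrt 2 : ℂ))⁻¹ := by
    rw [← Complex.ofReal_inv]
    exact Complex.conj_ofReal _
  generalize ((Real.sqrt 2 : ℂ))⁻¹ = s at *
  generalize ((Real.sqrt 3 : ℂ))⁻¹ = r at *
  have h1 : A₁ᴴ = s • !![0, 1, 0; 0, 0, 1; 0, 0, 1] := by
    rw [hA₁, conjTranspose_smul, hc]
    congr 1
    ext i j
    fin_cases i <;> fin_cases j <;> simp [conjTranspose_apply]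
  have h2 : A₂ᴴ = s • !![1, 0, 0; 1, 0, 0; 0, 1, 0] := by
    rw [hA₂, conjTranspose_smul, hc]
    congr 1
    ext i j
    fin_cases i <;> fin_cases j <;> simp [conjTranspose_apply]
  rw [h1, h2, hA₁, hA₂, hΩ]
  refine ⟨?_, ⟨?_, ?_⟩, ?_⟩
  · simp only [smul_mul_smul_comm, hs]
    ext i j
    fin_cases i <;> fin_cases j <;>
      norm_num [Matrix.mul_apply, Fin.sum_univ_three, Matrix.one_apply]
  · ext i
    fin_cases i <;> simp [Matrix.mulVec, dotProduct, Fin.sum_univ_three]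
  · ext i
    fin_cases i <;> simp [Matrix.mulVec, dotProduct, Fin.sum_univ_three]
  · intro x hx
    simp only [smul_mul_assoc, mul_smul_comm, smul_smul, hs] at hx
    have h := fun i j => congrFun (congrFun hx i) j
    have e00 := h 0 0
    have e01 := h 0 1
    have e02 := h 0 2
    have e10 := h 1 0
    have e11 := h 1 1
    have e12 := h 1 2
    have e20 := h 2 0
    have e21 := h 2 1
    have e22 := h 2 2
    clear h hx h1 h2 hA₁ hA₂ hΩ hs hc
    simp only [Matrix.add_apply, Matrix.smul_apply, Matrix.mul_apply, Fin.sum_univ_three] at e00 e01 e02 e10 e11 e12 e20 e21 e22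
    simp at e00 e01 e02 e10 e11 e12 e20 e21 e22
    have z02 : x 0 2 = 0 := by grind
    have z20 : x 2 0 = 0 := by grind
    have z01 : x 0 1 = 0 := by grind
    have z12 : x 1 2 = 0 := by grind
    have z10 : x 1 0 = 0 := by grind
    have z21 : x 2 1 = 0 := by grind
    have d1 : x 1 1 = x 0 0 := by grind
    have d2 : x 2 2 = x 0 0 := by grind
    refine ⟨x 0 0, ?_⟩
    ext i j
    fin_cases i <;> fin_cases j <;> simp [z02, z20, z01, z12, z10, z21, d1, d2]
end

section
/- Let A₁ := (1/√2)·[[0,0,0],[1,0,0],[0,1,1]] and A₂ := (1/√2)·[[1,1,0],[0,0,1],[0,0,0]] in M₃(ℂ), Ω := (1/√3)·(1,1,1)ᵀ ∈ ℂ³, Q := 1 − |Ω⟩⟨Ω| = (1/3)·[[2,−1,−1],[−1,2,−1],[−1,−1,2]], and Å_i := A_iQ for i = 1,2; for α = (α₁,…,α_n) ∈ {1,2}ⁿ set Å_α := Å_{α₁}⋯Å_{α_n}. Then for every n ≥ 1, ∑_{α ∈ {1,2}ⁿ} Å_α Å_α* = (1/(3·2^{n−1}))·[[1,−1,0],[−1,2,−1],[0,−1,1]];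 in particular ∑_{α ∈ {1,2}ⁿ} Å_α Å_α* → 0 as n → ∞, so the restricted tuple (Å₁,Å₂) is *-stable. -/
open Matrix

lemma aux_rec (Ar : Fin 2 → Matrix (Fin 3) (Fin 3) ℂ) (n : ℕ) :
    (∑ α : Fin (n + 1) → Fin 2,
      (List.ofFn fun k => Ar (α k)).prod * ((List.ofFn fun k => Ar (α k)).prod)ᴴ) =
    ∑ i : Fin 2, Ar i * (∑ α : Fin n → Fin 2,
      (List.ofFn fun k => Ar (α k)).prod * ((List.ofFn fun k => Ar (α k)).prod)ᴴ) * (Ar i)ᴴ := by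
  rw [← (Fin.consEquiv (fun _ : Fin (n + 1) => Fin 2)).sum_comp, Fintype.sum_prod_type]
  refine Finset.sum_congr rfl fun i _ => ?_
  rw [Finset.mul_sum, Finset.sum_mul]
  refine Finset.sum_congr rfl fun α _ => ?_
  simp [Fin.consEquiv, List.ofFn_succ, Matrix.conjTranspose_mul, Matrix.mul_assoc]

lemma aux_sq_s17 : ((Real.sqrt 2 : ℂ))⁻¹ * ((Real.sqrt 2 : ℂ))⁻¹ = 2⁻¹ := by
  rw [← mul_inv, ← Complex.ofReal_mul, Real.mul_self_sqrt (by norm_num)]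
  norm_num

lemma aux_conj (c : ℂ) (hc : c = ((Real.sqrt 2 : ℂ))⁻¹) (B Q X : Matrix (Fin 3) (Fin 3) ℂ) :
    (c • B * Q) * X * (c • B * Q)ᴴ = (2 : ℂ)⁻¹ • (B * (Q * X * Qᴴ) * Bᴴ) := by
  have h : star c = c := by rw [hc]; simp
  have h2 : c * c = 2⁻¹ := by rw [hc]; exact aux_sq_s17
  rw [← h2]
  simp [Matrix.conjTranspose_mul, Matrix.conjTranspose_smul, smul_smul, Matrix.mul_assoc, -Complex.star_def, h]

lemma aux_c2 : (starRingEnd ℂ) 2 = 2 := Complex.conj_ofNat 2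

lemma aux_c3 : (starRingEnd ℂ) 3 = 3 := Complex.conj_ofNat 3

lemma aux_Q1 (Q : Matrix (Fin 3) (Fin 3) ℂ)
    (hQ : Q = (3 : ℂ)⁻¹ • !![2, -1, -1; -1, 2, -1; -1, -1, 2]) : Q * 1 * Qᴴ = Q := by
  subst hQ
  ext i j
  fin_cases i <;> fin_cases j <;>
    simp [Matrix.mul_apply, Fin.sum_univ_three, Matrix.conjTranspose_apply, Matrix.vecMul, dotProduct, aux_c2, aux_c3] <;> norm_num

lemma aux_QM (Q : Matrix (Fin 3) (Fin 3) ℂ)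
    (hQ : Q = (3 : ℂ)⁻¹ • !![2, -1, -1; -1, 2, -1; -1, -1, 2]) :
    Q * !![1, -1, 0; -1, 2, -1; 0, -1, 1] * Qᴴ = !![1, -1, 0; -1, 2, -1; 0, -1, 1] := by
  subst hQ
  ext i j
  fin_cases i <;> fin_cases j <;>
    simp [Matrix.mul_apply, Fin.sum_univ_three, Matrix.conjTranspose_apply, Matrix.vecMul, dotProduct, aux_c2, aux_c3] <;> norm_num

/-- For the explicit example, with `Q` the projection onto `{Ω}ᗮ` and
`Å_i = A_i Q`, one has for every `n ≥ 1` the formula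
`∑_{α ∈ {1,2}ⁿ} Å_α Å_α* = (1/(3·2^{n−1})) · [[1,−1,0],[−1,2,−1],[0,−1,1]]`;
in particular this tends to `0`, i.e. the restricted tuple is `*`-stable. -/
theorem example_star_stable
    (A₁ A₂ : Matrix (Fin 3) (Fin 3) ℂ)
    (hA₁ : A₁ = ((Real.sqrt 2 : ℂ))⁻¹ • !![0, 0, 0; 1, 0, 0; 0, 1, 1])
    (hA₂ : A₂ = ((Real.sqrt 2 : ℂ))⁻¹ • !![1, 1, 0; 0, 0, 1; 0, 0, 0])
    (Q : Matrix (Fin 3) (Fin 3) ℂ)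
    (hQ : Q = (3 : ℂ)⁻¹ • !![2, -1, -1; -1, 2, -1; -1, -1, 2])
    (Ar : Fin 2 → Matrix (Fin 3) (Fin 3) ℂ)
    (hAr : Ar = ![A₁ * Q, A₂ * Q]) :
    (∀ n : ℕ, 1 ≤ n →
      (∑ α : Fin n → Fin 2,
          (List.ofFn fun k => Ar (α k)).prod * ((List.ofFn fun k => Ar (α k)).prod)ᴴ) =
        ((3 * 2 ^ (n - 1) : ℂ))⁻¹ • !![1, -1, 0; -1, 2, -1; 0, -1, 1]) ∧
    Filter.Tendsto
      (fun n : ℕ => ∑ α : Fin n → Fin 2,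
        (List.ofFn fun k => Ar (α k)).prod * ((List.ofFn fun k => Ar (α k)).prod)ᴴ)
      Filter.atTop (nhds 0) := by
  have hform : ∀ n : ℕ,
      (∑ α : Fin (n + 1) → Fin 2,
          (List.ofFn fun k => Ar (α k)).prod * ((List.ofFn fun k => Ar (α k)).prod)ᴴ) =
        ((3 * 2 ^ n : ℂ))⁻¹ • !![1, -1, 0; -1, 2, -1; 0, -1, 1] := by
    intro n
    induction n with
    | zero =>
      rw [aux_rec, Fin.sum_univ_two]
      have h0 : (∑ α : Fin 0 → Fin 2,
          (List.ofFn fun k => Ar (α k)).prod * ((List.ofFn fun k => Ar (α k)).prod)ᴴ) = 1 := by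
        simp
      rw [h0, hAr, hA₁, hA₂]
      simp only [Matrix.cons_val_zero, Matrix.cons_val_one]
      rw [aux_conj _ rfl, aux_conj _ rfl, aux_Q1 Q hQ, hQ]
      ext i j
      fin_cases i <;> fin_cases j <;>
        simp [Matrix.mul_apply, Fin.sum_univ_three, Matrix.conjTranspose_apply, Matrix.vecMul, dotProduct, aux_c2, aux_c3] <;> norm_num
    | succ n ih =>
      rw [aux_rec, ih, Fin.sum_univ_two, hAr, hA₁, hA₂]
      simp only [Matrix.cons_val_zero, Matrix.cons_val_one, Matrix.mul_smul, Matrix.smul_mul _ (_ * _)]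
      rw [← smul_add]
      have e : ((3 * 2 ^ (n + 1) : ℂ))⁻¹ = (3 * 2 ^ n : ℂ)⁻¹ * 2⁻¹ := by
        rw [pow_succ, ← mul_assoc, mul_inv]
      rw [e, mul_smul]
      congr 1
      rw [aux_conj _ rfl, aux_conj _ rfl, aux_QM Q hQ, ← smul_add]
      congr 1
      ext i j
      fin_cases i <;> fin_cases j <;>
        simp [Matrix.mul_apply, Fin.sum_univ_three, Matrix.conjTranspose_apply, Matrix.vecMul, dotProduct, aux_c2, aux_c3] <;> norm_num
  refine ⟨fun n hn => ?_, ?_⟩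
  · obtain ⟨m, rfl⟩ := Nat.exists_eq_add_of_le' hn
    simpa using hform m
  · rw [← Filter.tendsto_add_atTop_iff_nat 1]
    simp only [hform]
    have h : Filter.Tendsto (fun n : ℕ => ((3 * 2 ^ n : ℂ))⁻¹) Filter.atTop (nhds 0) := by
      have h1 : Filter.Tendsto (fun n : ℕ => (3 : ℂ)⁻¹ * (2⁻¹ : ℂ) ^ n) Filter.atTop
          (nhds (3⁻¹ * 0)) :=
        (tendsto_pow_atTop_nhds_zero_of_norm_lt_one (by norm_num)).const_mul _
      rw [mul_zero] at h1
      refine h1.congr fun n => ?_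
      rw [mul_inv, inv_pow]
    have h2 := h.smul_const (!![1, -1, 0; -1, 2, -1; 0, -1, 1] : Matrix (Fin 3) (Fin 3) ℂ)
    rwa [zero_smul] at h2
end
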